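/- Let λ⁽¹⁾/μ⁽¹⁾, …, λ⁽ⁿ⁾/μ⁽ⁿ⁾ be n skew shapes, let λ = ⋃_i λ⁽ⁱ⁾ be the partition obtained by rearranging all parts of all λ⁽ⁱ⁾ in weakly decreasing order, and similarly μ = ⋃_i μ⁽ⁱ⁾. Then ∏_{i=1}^{n} s_{λ^{[i,n]}/μ^{[i,n]}} − ∏_{i=1}^{n} s_{λ⁽ⁱ⁾/μ⁽ⁱ⁾} is Schur nonnegative. -/

import Mathlib

/-- The complete homogeneous symmetric function `h_m` in `N` variables,
with `h_m = 0` for `m < 0`. -/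
noncomputable def homog (N : ℕ) (m : ℤ) : MvPolynomial (Fin N) ℤ :=
  if 0 ≤ m then MvPolynomial.hsymm (Fin N) ℤ m.toNat else 0

/-- The skew Schur polynomial `s_{λ/μ}` in `N` variables, given by the
Jacobi–Trudi determinant `det (h_{λ_i - μ_j - i + j})_{i,j=1}^k`, where the
partitions `lam`, `mu` are recorded 0-indexed (`lam 0 = λ_1`). -/
noncomputable def skewSchur (N k : ℕ) (lam mu : ℕ → ℕ) : MvPolynomial (Fin N) ℤ :=
  Matrix.det (Matrix.of fun i j : Fin k =>
    homog N ((lam i : ℤ) - (mu j : ℤ) - (i : ℤ) + (j : ℤ)))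

/-- A symmetric polynomial is Schur nonnegative if it is a linear combination
with nonnegative coefficients of Schur polynomials `s_λ`. -/
def IsSchurNonneg (N : ℕ) (f : MvPolynomial (Fin N) ℤ) : Prop :=
  ∃ (m : ℕ) (c : Fin m → ℕ) (k : Fin m → ℕ) (lam : Fin m → ℕ → ℕ),
    (∀ i, Antitone (lam i)) ∧ (∀ i j, k i ≤ j → lam i j = 0) ∧
    f = ∑ i, (c i : ℤ) • skewSchur N (k i) (lam i) (fun _ => 0)

section proofdev
open Finset


section partI
variable {R : Type*} [CommRing R] (x : ℕ → R)

noncomputable def geoS (a : R) : PowerSeries R := PowerSeries.mk (fun m => a ^ m)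

lemma geoS_mul (a : R) : geoS a * (1 - PowerSeries.C a * PowerSeries.X) = 1 := by
  have h : geoS a = 1 + geoS a * (PowerSeries.C a * PowerSeries.X) := by
    ext m
    rw [← mul_assoc]
    rcases m with _ | m
    · simp [geoS]
    · rw [map_add, PowerSeries.coeff_succ_mul_X, PowerSeries.coeff_mul_C]
      simp [geoS, PowerSeries.coeff_one, pow_succ]
  rw [mul_sub, mul_one]
  nth_rewrite 1 [h]
  ring

noncomputable def hhs (t : ℕ) : PowerSeries R := ∏ l ∈ range t, geoS (x l)

noncomputable def hh (t : ℕ) (m : ℤ) : R :=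
  if 0 ≤ m then PowerSeries.coeff m.toNat (hhs x t) else 0

lemma hh_neg (t : ℕ) (m : ℤ) (h : m < 0) : hh x t m = 0 := by
  simp [hh, not_le.mpr h]

lemma hh_zero (m : ℤ) : hh x 0 m = if m = 0 then 1 else 0 := by
  unfold hh hhs
  simp only [range_zero, prod_empty, PowerSeries.coeff_one]
  split_ifs <;> first | rfl | omega

lemma hhs_succ (t : ℕ) :
    hhs x (t+1) = hhs x t + hhs x (t+1) * (PowerSeries.C (x t) * PowerSeries.X) := by
  have h := geoS_mul (x t)
  have h2 : hhs x (t+1) = hhs x t * geoS (x t) := by simp [hhs, prod_range_succ]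
  rw [h2]
  linear_combination (hhs x t) * h

lemma hh_succ (t : ℕ) (m : ℤ) : hh x (t+1) m = hh x t m + x t * hh x (t+1) (m-1) := by
  unfold hh
  rcases lt_trichotomy m 0 with h | h | h
  · rw [if_neg (by omega), if_neg (by omega), if_neg (by omega)]; simp
  · subst h
    rw [if_pos le_rfl, if_pos le_rfl, if_neg (by omega), hhs_succ]
    simp [← mul_assoc]
  · obtain ⟨k, rfl⟩ : ∃ k : ℕ, m = k + 1 := ⟨(m-1).toNat, by omega⟩
    rw [if_pos (by omega), if_pos (by omega), if_pos (by omega)]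
    have e1 : ((k:ℤ)+1).toNat = k + 1 := by omega
    have e2 : ((k:ℤ)+1-1).toNat = k := by omega
    rw [e1, e2]
    nth_rewrite 1 [hhs_succ]
    rw [← mul_assoc, map_add, PowerSeries.coeff_succ_mul_X, PowerSeries.coeff_mul_C]
    ring

lemma hh_iter (t : ℕ) (m : ℤ) (d : ℕ) :
    hh x (t+1) m = ∑ s ∈ range d, x t ^ s * hh x t (m - s) + x t ^ d * hh x (t+1) (m - d) := by
  induction d with
  | zero => simp
  | succ d ih =>
    rw [ih, sum_range_succ, hh_succ x t (m - d)]
    push_cast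
    rw [show m - (d:ℤ) - 1 = m - (d + 1) by ring]
    ring

end partI

noncomputable def xv (N : ℕ) : ℕ → MvPolynomial (Fin N) ℤ :=
  fun t => if h : t < N then MvPolynomial.X ⟨t, h⟩ else 0

lemma hhs_xv (N : ℕ) : hhs (xv N) N = ∏ i : Fin N, geoS (MvPolynomial.X i : MvPolynomial (Fin N) ℤ) := by
  rw [hhs, Finset.prod_range]
  apply Finset.prod_congr rfl
  intro i _
  simp [xv]

lemma homog_eq (N : ℕ) (m : ℤ) : homog N m = hh (xv N) N m := by
  unfold homog hh
  split_ifs with h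
  swap; · rfl
  rw [hhs_xv]
  generalize m.toNat = d
  rw [PowerSeries.coeff_prod, MvPolynomial.hsymm]
  symm
  refine Finset.sum_bij' (i := fun p hp => (⟨Finsupp.toMultiset p, by
      rw [Finsupp.card_toMultiset]
      rw [Finset.mem_finsuppAntidiag] at hp
      rw [← hp.1, Finsupp.sum_fintype _ _ (fun _ => rfl)]; rfl⟩ : Sym (Fin N) d))
    (j := fun s _ => Multiset.toFinsupp s.1) ?_ ?_ ?_ ?_ ?_
  · intros; exact Finset.mem_univ _
  · intro s _
    rw [Finset.mem_finsuppAntidiag]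
    refine ⟨?_, by simp⟩
    have h1 := Finsupp.card_toMultiset (Multiset.toFinsupp s.1)
    rw [Multiset.toFinsupp_toMultiset, s.2, Finsupp.sum_fintype _ _ (fun _ => rfl)] at h1
    exact h1.symm
  · intros; simp
  · intros; ext; simp
  · intro p hp
    simp only [geoS, PowerSeries.coeff_mk]
    rw [Finsupp.toMultiset_map, Finsupp.prod_toMultiset]
    rw [Finsupp.prod_mapDomain_index (by simp) (by intros; simp [pow_add])]
    rw [Finsupp.prod_fintype _ _ (by simp)]


section partII
variable {R : Type*} [CommRing R] (x : ℕ → R)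

noncomputable def JT (t k : ℕ) (lam mu : ℕ → ℕ) : R :=
  Matrix.det (Matrix.of fun i j : Fin k =>
    hh x t ((lam i : ℤ) - (mu j : ℤ) - (i : ℤ) + (j : ℤ)))

def ext0 (k : ℕ) (v : Fin k → ℕ) : ℕ → ℕ := fun r => if h : r < k then v ⟨r, h⟩ else 0

lemma ext0_fin (k : ℕ) (v : Fin k → ℕ) (i : Fin k) : ext0 k v i = v i := by
  simp [ext0]

def ilSet (k : ℕ) (lam : ℕ → ℕ) : Finset (Fin k → ℕ) :=
  Fintype.piFinset (fun i : Fin k => Icc (lam (i+1)) (lam i))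

lemma hh_block (t : ℕ) (p q : ℕ) (hpq : q ≤ p) (c : ℤ) :
    hh x (t+1) (p + c) - x t ^ (p - q + 1) * hh x (t+1) (q + c - 1)
      = ∑ v ∈ Icc q p, x t ^ (p - v) * hh x t (v + c) := by
  rw [hh_iter x t _ (p - q + 1)]
  rw [show (p:ℤ) + c - ((p - q + 1 : ℕ) : ℤ) = q + c - 1 by omega]
  rw [add_sub_cancel_right]
  refine Finset.sum_bij' (i := fun s _ => p - s) (j := fun v _ => p - v) ?_ ?_ ?_ ?_ ?_
  · intro s hs; simp at hs ⊢; omega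
  · intro s hs; simp at hs ⊢; omega
  · intro s hs; simp at hs ⊢; omega
  · intro s hs; simp at hs ⊢; omega
  · intro s hs
    simp only [mem_range] at hs
    rw [show p - (p - s) = s by omega, show ((p - s : ℕ):ℤ) + c = p + c - s by omega]

def Emat (k : ℕ) (c : ℕ → R) : Matrix (Fin k) (Fin k) R :=
  Matrix.of fun i j => if i = j then 1 else if (j:ℕ) = i + 1 then - c i else 0

lemma Emat_det (k : ℕ) (c : ℕ → R) : (Emat k c).det = 1 := by
  rw [Matrix.det_of_isUpperTriangular]
  · simp [Emat]
  · intro i j hij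
    simp only [id] at hij
    have : (j:ℕ) < i := hij
    simp only [Emat, Matrix.of_apply]
    rw [if_neg (by rintro rfl; omega), if_neg (by omega)]

lemma Emat_mul (k : ℕ) (c : ℕ → R) (A : Matrix (Fin k) (Fin k) R) (i j : Fin k) :
    (Emat k c * A) i j = A i j - c i * (if h : (i:ℕ) + 1 < k then A ⟨i+1, h⟩ j else 0) := by
  rw [Matrix.mul_apply]
  simp only [Emat, Matrix.of_apply]
  have : ∀ l : Fin k, (if i = l then (1:R) else if (l:ℕ) = i + 1 then - c i else 0) * A l j
      = (if i = l then A l j else 0) + (if (l:ℕ) = i + 1 then - c i * A l j else 0) := by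
    intro l
    by_cases h1 : i = l
    · subst h1; simp
    · by_cases h2 : (l:ℕ) = i+1 <;> simp [h1, h2]
  simp only [this, Finset.sum_add_distrib, Finset.sum_ite_eq, mem_univ, if_true]
  split_ifs with h
  · rw [Finset.sum_eq_single ⟨i+1, h⟩]
    · simp; ring
    · intro b _ hb; rw [if_neg]; intro h'; apply hb; ext; exact h'
    · simp
  · rw [Finset.sum_eq_zero]
    · ring
    · intro l _; rw [if_neg]; omega

lemma JT_succ (t k : ℕ) (lam mu : ℕ → ℕ) (hl : Antitone lam) (hk : lam k = 0) :
    JT x (t+1) k lam mu = ∑ v ∈ ilSet k lam,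
      x t ^ (∑ i : Fin k, (lam i - v i)) * JT x t k (ext0 k v) mu := by
  unfold JT
  set A : Matrix (Fin k) (Fin k) R := Matrix.of fun i j : Fin k =>
    hh x (t+1) ((lam i : ℤ) - (mu j : ℤ) - (i : ℤ) + (j : ℤ)) with hA
  have h1 : A.det = (Emat k (fun i => x t ^ (lam i - lam (i+1) + 1)) * A).det := by
    rw [Matrix.det_mul, Emat_det, one_mul]
  have h2 : Emat k (fun i => x t ^ (lam i - lam (i+1) + 1)) * A
      = fun (i : Fin k) => ∑ v ∈ Icc (lam (i+1)) (lam i),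
        (fun j : Fin k => x t ^ (lam i - v) * hh x t ((v : ℤ) - (mu j : ℤ) - (i : ℤ) + (j : ℤ))) := by
    ext i j
    rw [Emat_mul, Finset.sum_apply]
    have hb := hh_block x t (lam i) (lam (i+1)) (hl (by omega)) (-(mu j : ℤ) - (i : ℤ) + (j : ℤ))
    have e1 : ∀ z : ℤ, z + (-(mu j : ℤ) - (i : ℤ) + (j : ℤ)) = z - (mu j : ℤ) - (i : ℤ) + (j : ℤ) := by
      intro z; ring
    simp only [e1] at hb
    rw [← hb, hA]
    simp only [Matrix.of_apply]
    congr 2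
    split_ifs with h
    · congr 1
      push_cast; ring
    · have : (i:ℕ) + 1 = k := by omega
      rw [hh_neg]
      rw [this, hk]; have := j.2; push_cast; omega
  rw [h1, h2]
  have h3 := (Matrix.detRowAlternating (R := R) (n := Fin k)).toMultilinearMap.map_sum_finset
    (fun (i : Fin k) (v : ℕ) => (fun j : Fin k => x t ^ (lam i - v) * hh x t ((v : ℤ) - (mu j : ℤ) - (i : ℤ) + (j : ℤ))))
    (fun i : Fin k => Icc (lam (i+1)) (lam i))
  refine Eq.trans h3 ?_
  apply Finset.sum_congr rfl
  intro v hv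
  refine Eq.trans (Matrix.det_mul_column (fun i : Fin k => x t ^ (lam i - v i))
    (Matrix.of fun i j : Fin k => hh x t ((v i : ℤ) - (mu j : ℤ) - (i : ℤ) + (j : ℤ)))) ?_
  rw [Finset.prod_pow_eq_pow_sum]
  simp only [ext0_fin]

open Classical in
lemma JT_zero (k : ℕ) (lam mu : ℕ → ℕ) (hl : Antitone lam) (hm : Antitone mu)
    (hlk : ∀ r, k ≤ r → lam r = 0) (hmk : ∀ r, k ≤ r → mu r = 0) :
    JT x 0 k lam mu = if lam = mu then 1 else 0 := by
  unfold JT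
  simp only [hh_zero]
  split_ifs with h
  · subst h
    have : (Matrix.of fun i j : Fin k =>
      if (lam i : ℤ) - (lam j : ℤ) - (i : ℤ) + (j : ℤ) = 0 then (1:R) else 0) = 1 := by
      ext i j
      rw [Matrix.one_apply]
      simp only [Matrix.of_apply]
      congr 1
      apply propext
      constructor
      · intro h
        ext
        rcases lt_trichotomy (i:ℕ) j with h1 | h1 | h1
        · have := hl h1.le; omega
        · exact h1
        · have := hl h1.le; omega
      · rintro rfl; ring
    rw [this, Matrix.det_one]
  · have hex : ∃ r, lam r ≠ mu r := by
      by_contra hc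
      push Not at hc
      exact h (funext hc)
    classical
    let r := Nat.find hex
    have hr : lam r ≠ mu r := Nat.find_spec hex
    have hlt : ∀ s < r, lam s = mu s := fun s hs => by
      have := Nat.find_min hex hs; push Not at this; exact this
    have hrk : r < k := by
      by_contra hc
      push Not at hc
      rw [hlk r hc, hmk r hc] at hr; exact hr rfl
    rcases lt_or_gt_of_ne hr with h1 | h1
    · apply Matrix.det_eq_zero_of_column_eq_zero ⟨r, hrk⟩
      intro i
      simp only [Matrix.of_apply]
      rw [if_neg]
      rcases lt_or_ge (i:ℕ) r with h2 | h2
      · have a1 := hlt i h2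
        have a2 := hm h2.le
        omega
      · have a1 := hl h2
        omega
    · apply Matrix.det_eq_zero_of_row_eq_zero ⟨r, hrk⟩
      intro i
      simp only [Matrix.of_apply]
      rw [if_neg]
      rcases lt_or_ge (i:ℕ) r with h2 | h2
      · have a1 := hlt i h2
        have a2 := hl h2.le
        omega
      · have a1 := hm h2
        omega
end partII

section partIII
variable {R : Type*} [CommRing R] (x : ℕ → R)

open Classical in
noncomputable def GT (k : ℕ) : ℕ → (ℕ → ℕ) → (ℕ → ℕ) → Finset (ℕ → ℕ → ℕ)
  | 0, lam, mu => if lam = mu then {fun s => if s = 0 then lam else 0} else ∅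
  | (t+1), lam, mu => (ilSet k lam).biUnion fun v =>
      (GT k t (ext0 k v) mu).image (fun T => Function.update T (t+1) lam)

lemma mem_GT (k t : ℕ) (lam mu : ℕ → ℕ) (hlk : ∀ r, k ≤ r → lam r = 0) (T : ℕ → ℕ → ℕ) :
    T ∈ GT k t lam mu ↔ (∀ s, t < s → T s = 0) ∧ T t = lam ∧ T 0 = mu ∧
      ∀ s, s < t → ∀ r, T (s+1) (r+1) ≤ T s r ∧ T s r ≤ T (s+1) r := by
  classical
  induction t generalizing lam T with
  | zero =>
    simp only [GT]
    split_ifs with h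
    · subst h
      simp only [mem_singleton]
      constructor
      · rintro rfl
        refine ⟨?_, by simp, by simp, by simp⟩
        intro s hs; simp [hs.ne']
      · rintro ⟨h1, h2, -, -⟩
        funext s
        by_cases hs : s = 0
        · subst hs; simp [h2]
        · simp [hs, h1 s (by omega)]
    · simp only [notMem_empty, false_iff]
      rintro ⟨h1, h2, h3, -⟩
      exact h (h2 ▸ h3)
  | succ t ih =>
    simp only [GT, mem_biUnion, mem_image]
    constructor
    · rintro ⟨v, hv, T', hT', rfl⟩
      rw [ih _ (by intro r hr; simp [ext0, not_lt.mpr hr])] at hT'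
      obtain ⟨h1, h2, h3, h4⟩ := hT'
      refine ⟨?_, by simp, by simp [Function.update, h3], ?_⟩
      · intro s hs
        rw [Function.update_of_ne (by omega)]; exact h1 s (by omega)
      · intro s hs r
        rcases Nat.lt_succ_iff_lt_or_eq.mp hs with h5 | h5
        · rw [Function.update_of_ne (by omega), Function.update_of_ne (by omega)]
          exact h4 s h5 r
        · subst h5
          rw [Function.update_self, Function.update_of_ne (by omega), h2]
          unfold ext0
          split_ifs with hr
          · have := Fintype.mem_piFinset.mp hv ⟨r, hr⟩
            simpa using this
          · rw [hlk (r+1) (by omega)]; simp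
    · rintro ⟨h1, h2, h3, h4⟩
      have hTt : T t = ext0 k (fun i => T t i) := by
        funext r
        unfold ext0
        split_ifs with hr
        · rfl
        · have := (h4 t (by omega) r).2
          rw [h2, hlk r (by omega)] at this; omega
      refine ⟨fun i => T t i, ?_, Function.update T (t+1) 0, ?_, ?_⟩
      · rw [ilSet, Fintype.mem_piFinset]
        intro i
        rw [mem_Icc, ← h2]
        exact h4 t (by omega) i
      · rw [ih _ (by intro r hr; simp [ext0, not_lt.mpr hr])]
        refine ⟨?_, ?_, ?_, ?_⟩
        · intro s hs
          by_cases h5 : s = t + 1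
          · subst h5; simp
          · rw [Function.update_of_ne h5]; exact h1 s (by omega)
        · rw [Function.update_of_ne (by omega)]; exact hTt
        · rw [Function.update_of_ne (by omega)]; exact h3
        · intro s hs r
          rw [Function.update_of_ne (by omega), Function.update_of_ne (by omega)]
          exact h4 s (by omega) r
      · rw [Function.update_idem, ← h2, Function.update_eq_self]

def rsum (k : ℕ) (f : ℕ → ℕ) : ℕ := ∑ r ∈ range k, f r

lemma JT_eq_sum (k t : ℕ) (lam mu : ℕ → ℕ) (hl : Antitone lam) (hm : Antitone mu)
    (hlk : ∀ r, k ≤ r → lam r = 0) (hmk : ∀ r, k ≤ r → mu r = 0) :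
    JT x t k lam mu = ∑ T ∈ GT k t lam mu, ∏ s ∈ range t, x s ^ (rsum k (T (s+1)) - rsum k (T s)) := by
  classical
  induction t generalizing lam with
  | zero =>
    rw [JT_zero x k lam mu hl hm hlk hmk]
    simp only [GT]
    split_ifs <;> simp
  | succ t ih =>
    have hek : ∀ v : Fin k → ℕ, ∀ r, k ≤ r → ext0 k v r = 0 := by
      intro v r hr; simp [ext0, not_lt.mpr hr]
    rw [JT_succ x t k lam mu hl (hlk k le_rfl)]
    simp only [GT]
    rw [Finset.sum_biUnion]
    · apply Finset.sum_congr rfl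
      intro v hv
      have hv' := Fintype.mem_piFinset.mp hv
      simp only [mem_Icc] at hv'
      rw [Finset.sum_image]
      · rw [ih (ext0 k v) ?_ (hek v), Finset.mul_sum]
        · apply Finset.sum_congr rfl
          intro T hT
          rw [mem_GT _ _ _ _ (hek v)] at hT
          rw [Finset.prod_range_succ, mul_comm]
          congr 1
          · apply Finset.prod_congr rfl
            intro s hs
            simp only [mem_range] at hs
            rw [Function.update_of_ne (by omega), Function.update_of_ne (by omega)]
          · rw [Function.update_self, Function.update_of_ne (by omega), hT.2.1]
            congr 1
            unfold rsum
            rw [Finset.sum_tsub_distrib _ (fun i _ => (hv' i).2)]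
            rw [Finset.sum_range, Finset.sum_range]
            simp only [ext0_fin]
        · apply antitone_nat_of_succ_le
          intro r
          unfold ext0
          split_ifs with h1 h2 h2
          · have a1 := (hv' ⟨r, h2⟩).1
            have a2 := (hv' ⟨r+1, h1⟩).2
            simp only at a1 a2
            omega
          · omega
          · omega
          · omega
      · intro T hT T' hT' hTT
        rw [mem_coe, mem_GT _ _ _ _ (hek v)] at hT hT'
        have a1 : Function.update (Function.update T (t+1) lam) (t+1) 0 = T := by
          rw [Function.update_idem, Function.update_eq_self_iff]; exact (hT.1 _ (by omega)).symm
        have a2 : Function.update (Function.update T' (t+1) lam) (t+1) 0 = T' := by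
          rw [Function.update_idem, Function.update_eq_self_iff]; exact (hT'.1 _ (by omega)).symm
        simp only at hTT
        rw [← a1, ← a2, hTT]
    · intro v _ v' _ hvv
      rw [Function.onFun, Finset.disjoint_left]
      intro T hT hT'
      simp only [mem_image] at hT hT'
      obtain ⟨T1, h1, rfl⟩ := hT
      obtain ⟨T2, h2, h3⟩ := hT'
      rw [mem_GT _ _ _ _ (hek _)] at h1 h2
      apply hvv
      have h4 := congrFun h3 t
      rw [Function.update_of_ne (by omega), Function.update_of_ne (by omega), h1.2.1, h2.2.1] at h4
      funext i
      have h5 := congrFun h4 i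
      rw [ext0_fin, ext0_fin] at h5
      exact h5.symm
end partIII

lemma skewSchur_eq_JT (N k : ℕ) (lam mu : ℕ → ℕ) : skewSchur N k lam mu = JT (xv N) N k lam mu := by
  unfold skewSchur JT
  simp only [homog_eq]


def il (a b : ℕ → ℕ) : ℕ → ℕ := fun e => if e % 2 = 0 then a (e / 2) else b (e / 2)

lemma il_even (a b : ℕ → ℕ) (r : ℕ) : il a b (2 * r) = a r := by
  simp [il]

lemma il_odd (a b : ℕ → ℕ) (r : ℕ) : il a b (2 * r + 1) = b r := by
  unfold il
  rw [if_neg (by omega), show (2 * r + 1) / 2 = r by omega]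

lemma rsum_il (k : ℕ) (a b : ℕ → ℕ) : rsum (2 * k) (il a b) = rsum k a + rsum k b := by
  unfold rsum
  induction k with
  | zero => simp
  | succ k ih =>
    rw [show 2 * (k + 1) = 2 * k + 1 + 1 by ring]
    simp only [sum_range_succ, ih, il_even, il_odd]
    ring

open Classical in
noncomputable def PW (k N : ℕ) (lam mu nu rho : ℕ → ℕ) : Finset (ℕ → ℕ → ℕ) :=
  (GT k N lam mu ×ˢ GT k N nu rho).image (fun p t => il (p.1 t) (p.2 t))

lemma mem_PW (k N : ℕ) (lam mu nu rho : ℕ → ℕ) (hlk : ∀ r, k ≤ r → lam r = 0)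
    (hnk : ∀ r, k ≤ r → nu r = 0) (W : ℕ → ℕ → ℕ) :
    W ∈ PW k N lam mu nu rho ↔ (∀ s, N < s → W s = 0) ∧ W N = il lam nu ∧ W 0 = il mu rho ∧
      ∀ s, s < N → ∀ e, W (s+1) (e+2) ≤ W s e ∧ W s e ≤ W (s+1) e := by
  classical
  simp only [PW, mem_image, mem_product, Prod.exists]
  constructor
  · rintro ⟨T, U, ⟨hT, hU⟩, rfl⟩
    rw [mem_GT _ _ _ _ hlk] at hT
    rw [mem_GT _ _ _ _ hnk] at hU
    refine ⟨?_, ?_, ?_, ?_⟩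
    · intro s hs; simp only [hT.1 s hs, hU.1 s hs]; funext e; simp [il]
    · simp only [hT.2.1, hU.2.1]
    · simp only [hT.2.2.1, hU.2.2.1]
    · intro s hs e
      unfold il
      have h2 : (e + 2) / 2 = e / 2 + 1 := by omega
      have h3 : (e + 2) % 2 = e % 2 := by omega
      simp only [h2, h3]
      split_ifs
      · exact hT.2.2.2 s hs _
      · exact hU.2.2.2 s hs _
  · rintro ⟨h1, h2, h3, h4⟩
    refine ⟨fun t r => W t (2 * r), fun t r => W t (2 * r + 1), ⟨?_, ?_⟩, ?_⟩
    · rw [mem_GT _ _ _ _ hlk]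
      refine ⟨?_, ?_, ?_, ?_⟩
      · intro s hs; simp only [h1 s hs]; rfl
      · funext r; simp only [h2]; rw [il_even]
      · funext r; simp only [h3]; rw [il_even]
      · intro s hs r
        exact h4 s hs (2 * r)
    · rw [mem_GT _ _ _ _ hnk]
      refine ⟨?_, ?_, ?_, ?_⟩
      · intro s hs; simp only [h1 s hs]; rfl
      · funext r; simp only [h2]; rw [il_odd]
      · funext r; simp only [h3]; rw [il_odd]
      · intro s hs r
        exact h4 s hs (2 * r + 1)
    · funext t e
      unfold il
      split_ifs with h
      · simp only [show 2 * (e / 2) = e by omega]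
      · simp only [show 2 * (e / 2) + 1 = e by omega]

def wtW (K : ℕ) (W : ℕ → ℕ → ℕ) (s : ℕ) : ℕ := rsum K (W (s+1)) - rsum K (W s)

noncomputable def mon (N : ℕ) (v : ℕ → ℕ) : MvPolynomial (Fin N) ℤ :=
  ∏ i : Fin N, MvPolynomial.X i ^ v i

lemma mon_eq (N : ℕ) (v : ℕ → ℕ) : mon N v = ∏ s ∈ range N, xv N s ^ v s := by
  rw [mon, Finset.prod_range]
  apply Finset.prod_congr rfl
  intro i _
  simp [xv]

lemma skewSchur_eq_sum (N k : ℕ) (lam mu : ℕ → ℕ) (hl : Antitone lam) (hm : Antitone mu)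
    (hlk : ∀ r, k ≤ r → lam r = 0) (hmk : ∀ r, k ≤ r → mu r = 0) :
    skewSchur N k lam mu = ∑ T ∈ GT k N lam mu, mon N (wtW k T) := by
  rw [skewSchur_eq_JT, JT_eq_sum _ _ _ _ _ hl hm hlk hmk]
  apply Finset.sum_congr rfl
  intro T _
  rw [mon_eq]; rfl

lemma pair_eq_sum (N k : ℕ) (lam mu nu rho : ℕ → ℕ) (hl : Antitone lam) (hm : Antitone mu)
    (hlk : ∀ r, k ≤ r → lam r = 0) (hmk : ∀ r, k ≤ r → mu r = 0)
    (hn : Antitone nu) (hr : Antitone rho)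
    (hnk : ∀ r, k ≤ r → nu r = 0) (hrk : ∀ r, k ≤ r → rho r = 0) :
    skewSchur N k lam mu * skewSchur N k nu rho
      = ∑ W ∈ PW k N lam mu nu rho, mon N (wtW (2 * k) W) := by
  classical
  rw [skewSchur_eq_sum N k lam mu hl hm hlk hmk, skewSchur_eq_sum N k nu rho hn hr hnk hrk]
  rw [Finset.sum_mul_sum, ← Finset.sum_product', PW, Finset.sum_image]
  · apply Finset.sum_congr rfl
    rintro ⟨T, U⟩ h
    rw [mem_product] at h
    have hT := h.1
    have hU := h.2
    simp only at hT hU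
    rw [mem_GT _ _ _ _ hlk] at hT
    rw [mem_GT _ _ _ _ hnk] at hU
    simp only [mon, ← Finset.prod_mul_distrib]
    apply Finset.prod_congr rfl
    intro i _
    rw [← pow_add]
    congr 1
    simp only [wtW, rsum_il]
    have a1 : rsum k (T i) ≤ rsum k (T (i+1)) := Finset.sum_le_sum fun r _ => (hT.2.2.2 i i.2 r).2
    have a2 : rsum k (U i) ≤ rsum k (U (i+1)) := Finset.sum_le_sum fun r _ => (hU.2.2.2 i i.2 r).2
    omega
  · rintro ⟨T, U⟩ _ ⟨T', U'⟩ _ h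
    simp only at h
    have : ∀ t e, il (T t) (U t) e = il (T' t) (U' t) e := fun t e => congrFun (congrFun h t) e
    refine Prod.ext ?_ ?_
    · funext t r
      have := this t (2 * r)
      rwa [il_even, il_even] at this
    · funext t r
      have := this t (2 * r + 1)
      rwa [il_odd, il_odd] at this

lemma homog_rename (N : ℕ) (σ : Equiv.Perm (Fin N)) (m : ℤ) :
    MvPolynomial.rename σ (homog N m) = homog N m := by
  unfold homog
  split_ifs
  · exact MvPolynomial.hsymm_isSymmetric (Fin N) ℤ m.toNat σ
  · simp

lemma skewSchur_rename (N k : ℕ) (lam mu : ℕ → ℕ) (σ : Equiv.Perm (Fin N)) :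
    MvPolynomial.rename σ (skewSchur N k lam mu) = skewSchur N k lam mu := by
  unfold skewSchur
  rw [AlgHom.map_det]
  congr 1
  ext1 i j
  simp [AlgHom.mapMatrix_apply, homog_rename]

noncomputable def alt (N : ℕ) (v : ℕ → ℕ) : MvPolynomial (Fin N) ℤ :=
  Matrix.det (Matrix.of fun i j : Fin N => (MvPolynomial.X j : MvPolynomial (Fin N) ℤ) ^ v i)

lemma alt_eq (N : ℕ) (v : ℕ → ℕ) : alt N v =
    ∑ σ : Equiv.Perm (Fin N), (Equiv.Perm.sign σ : ℤ) • MvPolynomial.rename σ (mon N v) := by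
  rw [alt, ← Matrix.det_transpose, Matrix.det_apply]
  apply Finset.sum_congr rfl
  intro σ _
  simp only [mon, map_prod, map_pow, MvPolynomial.rename_X]
  rfl

lemma alt_mul (N : ℕ) (v : ℕ → ℕ) (f : MvPolynomial (Fin N) ℤ)
    (hf : ∀ σ : Equiv.Perm (Fin N), MvPolynomial.rename σ f = f)
    {ι : Type*} (s : Finset ι) (wt : ι → ℕ → ℕ) (hs : f = ∑ w ∈ s, mon N (wt w)) :
    alt N v * f = ∑ w ∈ s, alt N (fun i => v i + wt w i) := by
  simp only [alt_eq]
  rw [Finset.sum_comm, Finset.sum_mul]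
  apply Finset.sum_congr rfl
  intro σ _
  rw [smul_mul_assoc, ← hf σ, ← map_mul, hs, Finset.mul_sum, map_sum, Finset.smul_sum]
  apply Finset.sum_congr rfl
  intro w _
  congr 2
  simp only [mon, ← Finset.prod_mul_distrib, pow_add]

lemma coeff_mul_poly {R : Type*} [CommRing R] (A : PowerSeries R) (G : Polynomial R) (N n : ℕ)
    (hG : G.natDegree < N) :
    PowerSeries.coeff n (A * (G : PowerSeries R))
      = ∑ p ∈ range N, (if p ≤ n then PowerSeries.coeff (n - p) A else 0) * G.coeff p := by
  rw [mul_comm, PowerSeries.coeff_mul, Finset.Nat.sum_antidiagonal_eq_sum_range_succ_mk]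
  simp only [Polynomial.coeff_coe]
  trans ∑ p ∈ range (max N (n+1)), (if p ≤ n then PowerSeries.coeff (n - p) A else 0) * G.coeff p
  · symm
    rw [← Finset.sum_subset (s₁ := range (n+1))]
    · apply Finset.sum_congr rfl
      intro p hp
      simp only [mem_range] at hp
      rw [if_pos (by omega), mul_comm]
    · intro p hp; simp only [mem_range] at hp ⊢; omega
    · intro p hp hp'; simp only [mem_range] at hp hp'; rw [if_neg (by omega), zero_mul]
  · symm
    apply Finset.sum_subset
    · intro p hp; simp only [mem_range] at hp ⊢; omega
    · intro p hp hp'; simp only [mem_range] at hp hp'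
      rw [Polynomial.coeff_eq_zero_of_natDegree_lt (by omega), mul_zero]

noncomputable def Gp (N : ℕ) (k : Fin N) : Polynomial (MvPolynomial (Fin N) ℤ) :=
  ∏ l ∈ univ.erase k, (1 - Polynomial.C (MvPolynomial.X l) * Polynomial.X)

lemma Gp_deg (N : ℕ) (k : Fin N) : (Gp N k).natDegree < N := by
  unfold Gp
  have h1 := Polynomial.natDegree_prod_le (univ.erase k)
    (fun l => (1 - Polynomial.C (MvPolynomial.X l : MvPolynomial (Fin N) ℤ) * Polynomial.X))
  have h2 : ∑ l ∈ univ.erase k, (1 - Polynomial.C (MvPolynomial.X l : MvPolynomial (Fin N) ℤ) * Polynomial.X).natDegree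
      ≤ ∑ l ∈ univ.erase k, 1 := by
    apply Finset.sum_le_sum
    intro l _
    compute_degree
  have h3 : ∑ l ∈ univ.erase k, 1 = N - 1 := by simp
  have := k.2
  omega

lemma hhs_mul_Gp (N : ℕ) (k : Fin N) :
    hhs (xv N) N * (Gp N k : PowerSeries (MvPolynomial (Fin N) ℤ)) = geoS (MvPolynomial.X k) := by
  have h : ((Gp N k : Polynomial _) : PowerSeries (MvPolynomial (Fin N) ℤ))
      = ∏ l ∈ univ.erase k, (1 - PowerSeries.C (MvPolynomial.X l) * PowerSeries.X) := by
    unfold Gp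
    rw [← Polynomial.coeToPowerSeries.ringHom_apply, map_prod]
    simp
  rw [h, hhs_xv, ← Finset.mul_prod_erase univ _ (Finset.mem_univ k), mul_assoc,
    ← Finset.prod_mul_distrib]
  simp [geoS_mul]

lemma pow_eq_sum (N : ℕ) (k : Fin N) (c : ℕ) (i : Fin N) :
    (MvPolynomial.X k : MvPolynomial (Fin N) ℤ) ^ (c + (N - 1 - i))
      = ∑ j : Fin N, homog N ((c:ℤ) - ((0:ℕ):ℤ) - i + j) * (Gp N k).coeff (N - 1 - j) := by
  have h : (MvPolynomial.X k : MvPolynomial (Fin N) ℤ) ^ (c + (N - 1 - i))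
    = PowerSeries.coeff (c + (N - 1 - i)) (geoS (MvPolynomial.X k : MvPolynomial (Fin N) ℤ)) := by
    simp [geoS]
  rw [h, ← hhs_mul_Gp, coeff_mul_poly _ _ N _ (Gp_deg N k), ← Finset.sum_range_reflect,
    Finset.sum_range]
  apply Finset.sum_congr rfl
  intro j _
  congr 1
  rw [homog_eq, hh]
  have := i.2
  have := j.2
  by_cases h1 : N - 1 - (j:ℕ) ≤ c + (N - 1 - i)
  · rw [if_pos h1, if_pos (by omega)]
    rw [show ((c:ℤ) - ((0:ℕ):ℤ) - i + j).toNat = c + (N - 1 - i) - (N - 1 - j) by omega]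
  · rw [if_neg h1, if_neg (by omega)]

def rhoN (N : ℕ) (i : ℕ) : ℕ := N - 1 - i

noncomputable def Sf (N : ℕ) (lam : ℕ → ℕ) := skewSchur N N lam (fun _ => 0)

noncomputable def MatG (N : ℕ) : Matrix (Fin N) (Fin N) (MvPolynomial (Fin N) ℤ) :=
  Matrix.of fun j k => (Gp N k).coeff (N - 1 - j)

lemma alt_eq_mul (N : ℕ) (lam : ℕ → ℕ) :
    alt N (fun i => lam i + rhoN N i) = Sf N lam * (MatG N).det := by
  rw [Sf, skewSchur, ← Matrix.det_mul, alt]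
  congr 1
  ext1 i k
  rw [Matrix.mul_apply]
  exact pow_eq_sum N k (lam i) i

lemma skewSchur_zero (N k : ℕ) : skewSchur N k (fun _ => 0) (fun _ => 0) = 1 := by
  rw [skewSchur_eq_sum N k _ _ antitone_const antitone_const (by simp) (by simp)]
  have : GT k N (fun _ => 0) (fun _ => 0) = {fun _ _ => 0} := by
    ext T
    rw [mem_GT _ _ _ _ (by simp), mem_singleton]
    constructor
    · rintro ⟨h1, h2, h3, h4⟩
      have h5 : ∀ d, ∀ s, s + d = N → T s = fun _ => 0 := by
        intro d
        induction d with
        | zero => intro s hs; rw [show s = N by omega]; exact h2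
        | succ d ih =>
          intro s hs
          have h6 := ih (s+1) (by omega)
          funext r
          have := (h4 s (by omega) r).2
          rw [h6] at this
          simpa using this
      funext s
      rcases le_or_gt s N with h | h
      · exact h5 (N - s) s (by omega)
      · exact h1 s h
    · rintro rfl
      refine ⟨fun _ _ => rfl, rfl, rfl, by simp⟩
  rw [this]
  simp [mon, wtW]

lemma alt_rho (N : ℕ) : alt N (rhoN N) = (MatG N).det := by
  have h := alt_eq_mul N (fun _ => 0)
  rw [Sf, skewSchur_zero, one_mul] at h
  rw [← h]
  simp

lemma alt_rho_ne (N : ℕ) : alt N (rhoN N) ≠ 0 := by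
  have h : alt N (rhoN N) = (Matrix.projVandermonde (fun _ => 1)
      (fun i : Fin N => (MvPolynomial.X i : MvPolynomial (Fin N) ℤ))).det := by
    rw [alt, ← Matrix.det_transpose]
    congr 1
    ext1 i j
    simp only [Matrix.transpose_apply, Matrix.of_apply, Matrix.projVandermonde_apply, one_pow, one_mul]
    congr 1
    simp [rhoN, Fin.rev]; omega
  rw [h, Matrix.det_projVandermonde, Finset.prod_ne_zero_iff]
  intro i _
  rw [Finset.prod_ne_zero_iff]
  intro j hj
  rw [one_mul, one_mul, sub_ne_zero]
  intro h2
  have := MvPolynomial.X_injective h2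
  rw [mem_Ioi] at hj
  exact hj.ne this

lemma alt_Sf (N : ℕ) (lam : ℕ → ℕ) :
    alt N (fun i => lam i + rhoN N i) = Sf N lam * alt N (rhoN N) := by
  rw [alt_eq_mul, alt_rho]

lemma alt_swap (N : ℕ) (v v' : ℕ → ℕ) (i : ℕ) (hi : i + 1 < N) (h1 : v' i = v (i+1))
    (h2 : v' (i+1) = v i) (h3 : ∀ j, j ≠ i → j ≠ i + 1 → v' j = v j) :
    alt N v' = - alt N v := by
  let a : Fin N := ⟨i, by omega⟩
  let b : Fin N := ⟨i+1, hi⟩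
  have hab : a ≠ b := by simp [a, b]
  have h := Matrix.det_permute (Equiv.swap a b) (Matrix.of fun i j : Fin N => (MvPolynomial.X j : MvPolynomial (Fin N) ℤ) ^ v i)
  rw [Equiv.Perm.sign_swap hab] at h
  rw [alt, alt]
  simp only [Units.val_neg, Units.val_one, Int.cast_neg, Int.cast_one, neg_mul, one_mul] at h
  rw [← h]
  congr 1
  ext1 c j
  simp only [Matrix.submatrix_apply, Matrix.of_apply, id]
  congr 1
  by_cases hc : c = a
  · subst hc; rw [Equiv.swap_apply_left]; exact h1
  · by_cases hc2 : c = b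
    · subst hc2; rw [Equiv.swap_apply_right]; exact h2
    · rw [Equiv.swap_apply_of_ne_of_ne hc hc2]
      apply h3
      · intro h; exact hc (Fin.ext h)
      · intro h; exact hc2 (Fin.ext h)


lemma dv_le {K n d : ℕ} (hK : 0 < K) (h : K * d ≤ n) : d ≤ n / K := by
  rw [Nat.le_div_iff_mul_le hK, mul_comm]; exact h

lemma dv_ge {K n d : ℕ} (hK : 0 < K) (h : n < K * d + K) : n / K ≤ d := by
  rw [← Nat.lt_succ_iff, Nat.div_lt_iff_lt_mul hK, mul_comm, Nat.mul_succ]; exact h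

lemma dv_spec {K : ℕ} (hK : 0 < K) (n : ℕ) : K * (n / K) ≤ n ∧ n < K * (n / K) + K := by
  have h1 := Nat.div_add_mod n K
  have h2 := Nat.mod_lt n hK
  omega

/-- unread part of a row sequence -/
def AA (K q : ℕ) (f : ℕ → ℕ) : ℤ := ∑ e ∈ range K, ((f e - (q + e) / K : ℕ) : ℤ)

def balt (K q : ℕ) (X Y Z : ℕ → ℕ) : ℤ := 2 * AA K q Y - AA K q X - AA K q Z

def bterm (X Y Z : ℕ → ℕ) (m e : ℕ) : ℤ :=
  2 * ((Y e - m : ℕ) : ℤ) - ((X e - m : ℕ) : ℤ) - ((Z e - m : ℕ) : ℤ)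

lemma balt_eq (K q : ℕ) (X Y Z : ℕ → ℕ) :
    balt K q X Y Z = ∑ e ∈ range K, bterm X Y Z ((q + e) / K) e := by
  simp only [balt, AA, bterm, Finset.sum_sub_distrib, Finset.mul_sum]

structure Tri (K : ℕ) (X Y Z : ℕ → ℕ) : Prop where
  xy : ∀ e, Y (e+2) ≤ X e ∧ X e ≤ Y e
  yz : ∀ e, Z (e+2) ≤ Y e ∧ Y e ≤ Z e
  zz : ∀ e, K ≤ e → Z e = 0

lemma sum_ge_aux (K : ℕ) (d : ℕ → ℤ) (e : ℕ) (he : e < K) (hd : d e = 1)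
    (h1 : ∀ f < K, -1 ≤ d f) (h2 : ∀ f < K, ∀ g < K, f < g → d f < 0 → d g < 0 → False) :
    0 ≤ ∑ f ∈ range K, d f := by
  by_cases h : ∃ f < K, d f < 0
  · obtain ⟨f, hf, hdf⟩ := h
    have hfe : f ≠ e := by rintro rfl; omega
    rw [← Finset.add_sum_erase _ _ (mem_range.mpr he),
      ← Finset.add_sum_erase _ _ (mem_erase.mpr ⟨hfe, mem_range.mpr hf⟩)]
    have h3 : 0 ≤ ∑ x ∈ ((range K).erase e).erase f, d x := by
      apply Finset.sum_nonneg
      intro g hg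
      simp only [mem_erase, mem_range] at hg
      by_contra hc
      push Not at hc
      rcases lt_or_gt_of_ne hg.1 with h4 | h4
      · exact h2 g hg.2.2 f hf h4 hc hdf
      · exact h2 f hf g hg.2.2 h4 hdf hc
    have := h1 f hf
    omega
  · push Not at h
    exact Finset.sum_nonneg fun f hf => h f (mem_range.mp hf)

lemma Tri.z_anti {K : ℕ} {X Y Z : ℕ → ℕ} (h : Tri K X Y Z) (e d : ℕ) : Z (e + 2 * d) ≤ Z e := by
  induction d with
  | zero => simp
  | succ d ih =>
    have h1 := h.yz (e + 2 * d)
    rw [show e + 2 * (d + 1) = e + 2 * d + 2 by ring]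
    omega

lemma Tri.y_anti {K : ℕ} {X Y Z : ℕ → ℕ} (h : Tri K X Y Z) (e d : ℕ) : Y (e + 2 * d) ≤ Y e := by
  induction d with
  | zero => simp
  | succ d ih =>
    have h1 := h.xy (e + 2 * d)
    rw [show e + 2 * (d + 1) = e + 2 * d + 2 by ring]
    omega

lemma Tri.zy {K : ℕ} {X Y Z : ℕ → ℕ} (h : Tri K X Y Z) (e f : ℕ) (hef : e < f)
    (hp : e % 2 = f % 2) : Z f ≤ Y e := by
  obtain ⟨d, rfl⟩ : ∃ d, f = e + 2 + 2 * d := ⟨(f - e - 2) / 2, by omega⟩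
  exact (h.z_anti (e+2) d).trans (h.yz e).1

lemma Tri.yx {K : ℕ} {X Y Z : ℕ → ℕ} (h : Tri K X Y Z) (e f : ℕ) (hef : e < f)
    (hp : e % 2 = f % 2) : Y f ≤ X e := by
  obtain ⟨d, rfl⟩ : ∃ d, f = e + 2 + 2 * d := ⟨(f - e - 2) / 2, by omega⟩
  exact (h.y_anti (e+2) d).trans (h.xy e).1

lemma Tri.zz2 {K : ℕ} {X Y Z : ℕ → ℕ} (h : Tri K X Y Z) (e f : ℕ) (hef : e < f)
    (hp : e % 2 = f % 2) : Z f ≤ Z (e+2) := by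
  obtain ⟨d, rfl⟩ : ∃ d, f = e + 2 + 2 * d := ⟨(f - e - 2) / 2, by omega⟩
  exact (h.z_anti (e+2) d)

lemma bstep {K : ℕ} {X Y Z : ℕ → ℕ} (h : Tri K X Y Z) (m e : ℕ) :
    -1 ≤ bterm X Y Z m e - bterm X Y Z (m+1) e ∧
    (bterm X Y Z m e - bterm X Y Z (m+1) e < 0 → Y e < m + 1 ∧ m + 1 ≤ Z e) := by
  have h1 := (h.xy e).2
  have h2 := (h.yz e).2
  unfold bterm
  omega

lemma bstep2 {K : ℕ} {X Y Z : ℕ → ℕ} (h : Tri K X Y Z) (m m' e : ℕ) (hm : m' = m ∨ m' = m + 1) :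
    -1 ≤ bterm X Y Z m e - bterm X Y Z m' e ∧
    (bterm X Y Z m e - bterm X Y Z m' e < 0 → Y e < m' ∧ m' ≤ Z e) := by
  rcases hm with rfl | rfl
  · simp
  · exact bstep h m e

lemma nt_one {K : ℕ} (hK : 0 < K) {X Y Z : ℕ → ℕ} (h : Tri K X Y Z) (q : ℕ) (c : ℤ)
    (hq : c + balt K q X Y Z < 0) (hq1 : ∀ q1, q < q1 → 0 ≤ c + balt K q1 X Y Z)
    (e : ℕ) (he : e < K) (hY : (q + e) / K < Y e) : (q + e) / K ≤ max (X e) (Z (e+2)) := by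
  by_contra hc
  push Not at hc
  have hcX : X e < (q + e) / K := lt_of_le_of_lt (le_max_left _ _) hc
  have hcZ : Z (e+2) < (q + e) / K := lt_of_le_of_lt (le_max_right _ _) hc
  set m := (q + e) / K with hm
  have hsp := dv_spec hK (q + e)
  rw [← hm] at hsp
  have hmul : K * (m + 1) = K * m + K := by ring
  have hqq : q < K * (m + 1) - e := by omega
  have hb := hq1 _ hqq
  set q1 := K * (m + 1) - e with hq1d
  have key : 0 ≤ ∑ f ∈ range K, (bterm X Y Z ((q + f) / K) f - bterm X Y Z ((q1 + f) / K) f) := by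
    have hge : ∀ f < K, e ≤ f → (q1 + f) / K = m + 1 ∧ m ≤ (q + f) / K ∧ (q + f) / K ≤ m + 1 := by
      intro f hf hef
      refine ⟨le_antisymm (dv_ge hK (by omega)) (dv_le hK (by omega)), dv_le hK (by omega),
        dv_ge hK (by omega)⟩
    have hlt : ∀ f < K, f < e → (q1 + f) / K = m ∧ m ≤ (q + f) / K + 1 ∧ (q + f) / K ≤ m := by
      intro f hf hef
      refine ⟨le_antisymm (dv_ge hK (by omega)) (dv_le hK (by omega)), ?_,
        dv_ge hK (by omega)⟩
      have := dv_spec hK (q + f)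
      by_contra hcc
      push Not at hcc
      have h5 : K * ((q+f)/K + 1 + 1) ≤ K * m := Nat.mul_le_mul_left K hcc
      have h6 : K * ((q+f)/K + 1 + 1) = K * ((q+f)/K) + K + K := by ring
      omega
    have hst : ∀ f < K, (q1 + f) / K = (q + f) / K ∨ (q1 + f) / K = (q + f) / K + 1 := by
      intro f hf
      rcases le_or_gt e f with h1 | h1
      · have := hge f hf h1; omega
      · have := hlt f hf h1; omega
    have he1 := (hge e he le_rfl).1
    apply sum_ge_aux K _ e he
    · rw [he1, ← hm]
      have := (h.yz e).2
      unfold bterm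
      omega
    · intro f hf
      exact (bstep2 h _ _ f (hst f hf)).1
    · intro f hf g hg hfg hdf hdg
      have hpar : ∀ f < K, bterm X Y Z ((q + f) / K) f - bterm X Y Z ((q1 + f) / K) f < 0 → f % 2 ≠ e % 2 := by
        intro f hf hd hp
        have h3 := (bstep2 h _ _ f (hst f hf)).2 hd
        rcases lt_trichotomy f e with h1 | h1 | h1
        · have h4 := hlt f hf h1
          have h5 := h.yx f e h1 hp
          have h6 := (h.xy f).2
          omega
        · subst h1
          omega
        · have h4 := hge f hf h1.le
          have h5 := h.zz2 e f h1 hp.symm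
          omega
      have p1 := hpar f hf hdf
      have p2 := hpar g hg hdg
      have h3 := (bstep2 h _ _ f (hst f hf)).2 hdf
      have h4 := (bstep2 h _ _ g (hst g hg)).2 hdg
      have h5 := h.zy f g hfg (by omega)
      have h6 : (q1 + f) / K ≤ (q1 + g) / K := Nat.div_le_div_right (by omega)
      omega
  rw [Finset.sum_sub_distrib, ← balt_eq, ← balt_eq] at key
  omega

lemma nt_two {K : ℕ} (hK : 1 < K) {X Y Z : ℕ → ℕ} (h : Tri K X Y Z) (q : ℕ) (c : ℤ)
    (hq : c + balt K q X Y Z < 0) (hq1 : ∀ q1, q < q1 → 0 ≤ c + balt K q1 X Y Z)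
    (e : ℕ) (he : e < K) (hM : (q + (e+2)) / K = (q + e) / K + 1)
    (hX : X e < (q + e) / K + 1) (hZ : (q + e) / K + 1 ≤ Z (e+2)) : False := by
  have hK0 : 0 < K := by omega
  have heK : e + 2 < K := by
    by_contra hc
    rw [h.zz (e+2) (by omega)] at hZ
    omega
  set m := (q + e) / K with hm
  have hsp := dv_spec hK0 (q + e)
  have hsp2 := dv_spec hK0 (q + (e + 2))
  rw [← hm] at hsp
  rw [hM] at hsp2
  have hmul : K * (m + 1) = K * m + K := by ring
  have hqq : q < K * (m + 1) - e := by omega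
  have hb := hq1 _ hqq
  set q1 := K * (m + 1) - e with hq1d
  have key : 0 ≤ ∑ f ∈ range K, (bterm X Y Z ((q + f) / K) f - bterm X Y Z ((q1 + f) / K) f) := by
    have hgt : ∀ f < K, e + 1 < f → (q1 + f) / K = m + 1 ∧ (q + f) / K = m + 1 := by
      intro f hf hef
      exact ⟨le_antisymm (dv_ge hK0 (by omega)) (dv_le hK0 (by omega)),
        le_antisymm (dv_ge hK0 (by omega)) (dv_le hK0 (by omega))⟩
    have hlt : ∀ f < K, f < e → (q1 + f) / K = m ∧ (q + f) / K = m := by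
      intro f hf hef
      exact ⟨le_antisymm (dv_ge hK0 (by omega)) (dv_le hK0 (by omega)),
        le_antisymm (dv_ge hK0 (by omega)) (dv_le hK0 (by omega))⟩
    have he1 : (q1 + e) / K = m + 1 :=
      le_antisymm (dv_ge hK0 (by omega)) (dv_le hK0 (by omega))
    have he2 : (q1 + (e + 1)) / K = m + 1 :=
      le_antisymm (dv_ge hK0 (by omega)) (dv_le hK0 (by omega))
    have he3 : m ≤ (q + (e + 1)) / K ∧ (q + (e+1)) / K ≤ m + 1 :=
      ⟨dv_le hK0 (by omega), dv_ge hK0 (by omega)⟩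
    have hd : bterm X Y Z ((q + e) / K) e - bterm X Y Z ((q1 + e) / K) e = 1 := by
      rw [he1, ← hm]
      have := h.yz e
      unfold bterm
      omega
    have hz : ∀ f < K, f ≠ e → f ≠ e + 1 →
        bterm X Y Z ((q + f) / K) f - bterm X Y Z ((q1 + f) / K) f = 0 := by
      intro f hf h1 h2
      rcases lt_or_ge f e with h3 | h3
      · rw [(hlt f hf h3).1, (hlt f hf h3).2, sub_self]
      · rw [(hgt f hf (by omega)).1, (hgt f hf (by omega)).2, sub_self]
    apply sum_ge_aux K _ e he hd
    · intro f hf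
      by_cases h1 : f = e
      · subst h1; omega
      by_cases h2 : f = e + 1
      · subst h2
        exact (bstep2 h _ _ _ (by omega)).1
      · rw [hz f hf h1 h2]; omega
    · intro f hf g hg hfg h1 h2
      have h3 : f = e + 1 := by
        by_contra h5
        by_cases h6 : f = e
        · subst h6; omega
        · have := hz f hf h6 h5; omega
      have h4 : g = e + 1 := by
        by_contra h5
        by_cases h6 : g = e
        · subst h6; omega
        · have := hz g hg h6 h5; omega
      omega
  rw [Finset.sum_sub_distrib, ← balt_eq, ← balt_eq] at key
  omega

lemma balt_step {K : ℕ} (hK : 0 < K) {X Y Z : ℕ → ℕ} (h : Tri K X Y Z) (q : ℕ) :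
    balt K (q+1) X Y Z - 1 ≤ balt K q X Y Z := by
  have key : -1 ≤ ∑ f ∈ range K, (bterm X Y Z ((q + f) / K) f - bterm X Y Z ((q + 1 + f) / K) f) := by
    let e := K * (q / K + 1) - (q + 1)
    have hsp := dv_spec hK q
    have hmul : K * (q / K + 1) = K * (q / K) + K := by ring
    have hmul2 : K * (q / K + 2) = K * (q / K) + K + K := by ring
    have he : e < K := by omega
    rw [← Finset.add_sum_erase _ _ (mem_range.mpr he)]
    have h1 : ∑ f ∈ (range K).erase e, (bterm X Y Z ((q + f) / K) f - bterm X Y Z ((q + 1 + f) / K) f) = 0 := by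
      apply Finset.sum_eq_zero
      intro f hf
      simp only [mem_erase, mem_range] at hf
      have : (q + f) / K = (q + 1 + f) / K := by
        rcases lt_or_gt_of_ne hf.1 with h2 | h2
        · trans q / K
          · exact le_antisymm (dv_ge hK (by omega)) (dv_le hK (by omega))
          · exact (le_antisymm (dv_ge hK (by omega)) (dv_le hK (by omega))).symm
        · trans (q / K + 1)
          · exact le_antisymm (dv_ge hK (by omega)) (dv_le hK (by omega))
          · exact (le_antisymm (dv_ge hK (by omega)) (dv_le hK (by omega))).symm
      rw [this, sub_self]
    rw [h1, add_zero]
    apply (bstep2 h _ _ _ ?_).1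
    right
    have a1 : (q + e) / K = q / K := le_antisymm (dv_ge hK (by omega)) (dv_le hK (by omega))
    have a2 : (q + 1 + e) / K = q / K + 1 := le_antisymm (dv_ge hK (by omega)) (dv_le hK (by omega))
    rw [a1, a2]
  rw [Finset.sum_sub_distrib, ← balt_eq, ← balt_eq] at key
  omega

def Uf (X Z : ℕ → ℕ) (e : ℕ) : ℕ := if e < 2 then Z e else min (Z e) (X (e-2))
def Lf (X Z : ℕ → ℕ) (e : ℕ) : ℕ := max (X e) (Z (e+2))

def flipY (K q : ℕ) (X Y Z : ℕ → ℕ) (e : ℕ) : ℕ :=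
  if Y e ≤ (q + e) / K then Lf X Z e + min (Uf X Z e) ((q + e) / K) - Y e else Y e

lemma Tri.LU {K : ℕ} {X Y Z : ℕ → ℕ} (h : Tri K X Y Z) (e : ℕ) : Lf X Z e ≤ Y e ∧ Y e ≤ Uf X Z e := by
  refine ⟨max_le (h.xy e).2 (h.yz e).1, ?_⟩
  unfold Uf
  split_ifs with he
  · exact (h.yz e).2
  · refine le_min (h.yz e).2 ?_
    obtain ⟨d, rfl⟩ : ∃ d, e = d + 2 := ⟨e - 2, by omega⟩
    exact (h.xy d).1

lemma flip_LU {K : ℕ} {X Y Z : ℕ → ℕ} (h : Tri K X Y Z) (q e : ℕ) :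
    Lf X Z e ≤ flipY K q X Y Z e ∧ flipY K q X Y Z e ≤ Uf X Z e := by
  have := h.LU e
  unfold flipY
  split_ifs <;> omega

lemma flip_tri {K : ℕ} {X Y Z : ℕ → ℕ} (h : Tri K X Y Z) (q : ℕ) : Tri K X (flipY K q X Y Z) Z := by
  constructor
  · intro e
    have h1 := flip_LU h q e
    have h2 := flip_LU h q (e+2)
    have h3 : Uf X Z (e+2) ≤ X e := by
      unfold Uf; rw [if_neg (by omega)]; exact min_le_right _ _
    have h4 : X e ≤ Lf X Z e := le_max_left _ _
    omega
  · intro e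
    have h1 := flip_LU h q e
    have h3 : Uf X Z e ≤ Z e := by
      unfold Uf; split_ifs
      · exact le_rfl
      · exact min_le_left _ _
    have h4 : Z (e+2) ≤ Lf X Z e := le_max_right _ _
    omega
  · exact h.zz

lemma flipY_flipY {K : ℕ} {X Y Z : ℕ → ℕ} (h : Tri K X Y Z) (q : ℕ) :
    flipY K q X (flipY K q X Y Z) Z = Y := by
  funext e
  have := h.LU e
  simp only [flipY]
  split_ifs <;> omega

lemma flip_sub {K : ℕ} {X Y Z : ℕ → ℕ} (h : Tri K X Y Z) (q e m : ℕ) (hm : (q + e) / K ≤ m) :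
    flipY K q X Y Z e - m = Y e - m := by
  have := h.LU e
  simp only [flipY]
  split_ifs <;> omega

lemma flip_AA {K : ℕ} {X Y Z : ℕ → ℕ} (h : Tri K X Y Z) (q q' : ℕ) (hq : q ≤ q') :
    AA K q' (flipY K q X Y Z) = AA K q' Y := by
  unfold AA
  apply Finset.sum_congr rfl
  intro e _
  rw [flip_sub h q e _ (Nat.div_le_div_right (by omega))]

lemma sum_shift2 (K : ℕ) (u : ℕ → ℤ) (h0 : u K = 0) (h1 : u (K+1) = 0) :
    ∑ e ∈ range K, u e = u 0 + u 1 + ∑ e ∈ range K, u (e + 2) := by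
  have h2 : ∑ e ∈ range (K+2), u e = ∑ e ∈ range K, u e := by
    rw [sum_range_succ, sum_range_succ, h0, h1]; ring
  rw [← h2, sum_range_succ', sum_range_succ']
  ring_nf

lemma rsum_split (K q : ℕ) (f : ℕ → ℕ) :
    (rsum K f : ℤ) = ∑ e ∈ range K, ((min (f e) ((q + e) / K) : ℕ) : ℤ) + AA K q f := by
  unfold rsum AA
  rw [← Finset.sum_add_distrib]
  rw [Nat.cast_sum]
  apply Finset.sum_congr rfl
  intro e _
  omega

lemma flip_sum {K : ℕ} (hK : 1 < K) {X Y Z : ℕ → ℕ} (h : Tri K X Y Z) (q : ℕ) (c : ℤ)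
    (hq : c + balt K q X Y Z < 0) (hq1 : ∀ q1, q < q1 → 0 ≤ c + balt K q1 X Y Z) :
    (rsum K (flipY K q X Y Z) : ℤ) + rsum K Y = rsum K X + rsum K Z - 1 - c := by
  have hK0 : 0 < K := by omega
  have hb : c + balt K q X Y Z = -1 := by
    have h1 := balt_step hK0 h q
    have h2 := hq1 (q+1) (by omega)
    omega
  rw [rsum_split K q (flipY K q X Y Z), rsum_split K q Y, rsum_split K q X, rsum_split K q Z,
    flip_AA h q q le_rfl]
  have h1 : ∑ e ∈ range K, ((min (flipY K q X Y Z e) ((q + e) / K) : ℕ) : ℤ)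
      + ∑ e ∈ range K, ((min (Y e) ((q + e) / K) : ℕ) : ℤ)
      = ∑ e ∈ range K, ((min (Lf X Z e) ((q + e) / K) : ℕ) : ℤ)
      + ∑ e ∈ range K, ((min (Uf X Z e) ((q + e) / K) : ℕ) : ℤ) := by
    rw [← Finset.sum_add_distrib, ← Finset.sum_add_distrib]
    apply Finset.sum_congr rfl
    intro e he
    rw [mem_range] at he
    have a1 := h.LU e
    have a2 := nt_one hK0 h q c hq hq1 e he
    change _ → _ ≤ Lf X Z e at a2
    unfold flipY
    split_ifs with h3
    · omega
    · have := a2 (by omega)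
      omega
  have hZK : ∀ e, K ≤ e → Z e = 0 := h.zz
  have h2 : ∑ e ∈ range K, ((min (Lf X Z e) ((q + e) / K) : ℕ) : ℤ)
      + ∑ e ∈ range K, ((min (Uf X Z e) ((q + e) / K) : ℕ) : ℤ)
      = ∑ e ∈ range K, ((min (X e) ((q + e) / K) : ℕ) : ℤ)
      + ∑ e ∈ range K, ((min (Z e) ((q + e) / K) : ℕ) : ℤ) := by
    rw [sum_shift2 K (fun e => ((min (Uf X Z e) ((q + e) / K) : ℕ) : ℤ)),
      sum_shift2 K (fun e => ((min (Z e) ((q + e) / K) : ℕ) : ℤ))]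
    · have h3 : ∑ e ∈ range K, ((min (Lf X Z e) ((q + e) / K) : ℕ) : ℤ)
          + ∑ e ∈ range K, ((min (Uf X Z (e+2)) ((q + (e+2)) / K) : ℕ) : ℤ)
          = ∑ e ∈ range K, ((min (X e) ((q + e) / K) : ℕ) : ℤ)
          + ∑ e ∈ range K, ((min (Z (e+2)) ((q + (e+2)) / K) : ℕ) : ℤ) := by
        rw [← Finset.sum_add_distrib, ← Finset.sum_add_distrib]
        apply Finset.sum_congr rfl
        intro e he
        rw [mem_range] at he
        have a1 := nt_two hK h q c hq hq1 e he
        have a3 : (q + e) / K ≤ (q + (e+2)) / K := Nat.div_le_div_right (by omega)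
        have a4 : (q + (e+2)) / K ≤ (q + e) / K + 1 := by
          have := dv_spec hK0 (q + e)
          have hmul : K * ((q + e) / K + 1) = K * ((q+e) / K) + K := by ring
          exact dv_ge hK0 (by omega)
        have a5 : Uf X Z (e+2) = min (Z (e+2)) (X e) := by
          unfold Uf; rw [if_neg (by omega)]; rfl
        rw [a5, Lf]
        rcases le_or_gt (Z (e+2)) (X e) with h5 | h5
        · omega
        · have h6 : ¬ ((q + (e+2)) / K = (q + e) / K + 1 ∧ X e < (q + e) / K + 1 ∧ (q + e) / K + 1 ≤ Z (e+2)) :=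
            fun ⟨b1, b2, b3⟩ => a1 b1 b2 b3
          omega
      have u0 : Uf X Z 0 = Z 0 := by simp [Uf]
      have u1 : Uf X Z 1 = Z 1 := by simp [Uf]
      simp only [u0, u1]
      linarith
    · simp [hZK K le_rfl]
    · simp [hZK (K+1) (by omega)]
    · have : Uf X Z K = 0 := by
        unfold Uf; rw [hZK K le_rfl]; simp
      simp [this]
    · have : Uf X Z (K+1) = 0 := by
        unfold Uf; rw [hZK (K+1) (by omega)]; simp
      simp [this]
  unfold balt at hb
  linarith


def Bal (α : ℕ → ℕ) (K : ℕ) (W : ℕ → ℕ → ℕ) (i q : ℕ) : ℤ :=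
  ((α i : ℤ) - α (i+1)) + balt K q (W i) (W (i+1)) (W (i+2))

def Good (α : ℕ → ℕ) (N K : ℕ) (W : ℕ → ℕ → ℕ) : Prop :=
  ∀ q i, i + 1 < N → 0 ≤ Bal α K W i q

/-- the array conditions -/
structure Arr (N K : ℕ) (W : ℕ → ℕ → ℕ) : Prop where
  il : ∀ s, s < N → ∀ e, W (s+1) (e+2) ≤ W s e ∧ W s e ≤ W (s+1) e
  top : ∀ e, K ≤ e → W N e = 0
  out : ∀ s, N < s → W s = 0

lemma Arr.le {N K : ℕ} {W : ℕ → ℕ → ℕ} (h : Arr N K W) (t : ℕ) (ht : t ≤ N) (e : ℕ) : W t e ≤ W N e := by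
  obtain ⟨d, hd⟩ : ∃ d, N = t + d := ⟨N - t, by omega⟩
  induction d generalizing t with
  | zero => rw [show t = N by omega]
  | succ d ih =>
    exact ((h.il t (by omega) e).2).trans (ih (t+1) (by omega) (by omega))

lemma Arr.zero {N K : ℕ} {W : ℕ → ℕ → ℕ} (h : Arr N K W) (t e : ℕ) (he : K ≤ e) : W t e = 0 := by
  rcases le_or_gt t N with h1 | h1
  · have := h.le t h1 e
    rw [h.top e he] at this
    omega
  · rw [h.out t h1]; rfl

lemma Arr.tri {N K : ℕ} {W : ℕ → ℕ → ℕ} (h : Arr N K W) (i : ℕ) (hi : i + 1 < N) :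
    Tri K (W i) (W (i+1)) (W (i+2)) :=
  ⟨fun e => h.il i (by omega) e, fun e => h.il (i+1) (by omega) e, fun e he => h.zero _ e he⟩

lemma Arr.bal_large {N K : ℕ} (hK : 0 < K) {W : ℕ → ℕ → ℕ} (h : Arr N K W) (α : ℕ → ℕ) (hα : Antitone α) :
    ∃ Q, ∀ q, Q ≤ q → ∀ i, i + 1 < N → 0 ≤ Bal α K W i q := by
  refine ⟨K * rsum K (W N), ?_⟩
  intro q hq i hi
  have h1 : ∀ t, t ≤ N → AA K q (W t) = 0 := by
    intro t ht
    apply Finset.sum_eq_zero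
    intro e he
    have h2 := h.le t ht e
    have h3 : W N e ≤ rsum K (W N) := Finset.single_le_sum (f := W N) (fun _ _ => Nat.zero_le _) he
    have h4 : rsum K (W N) ≤ (q + e) / K := dv_le hK (by omega)
    omega
  unfold Bal balt
  rw [h1 i (by omega), h1 (i+1) (by omega), h1 (i+2) (by omega)]
  have := hα (Nat.le_succ i)
  simp only [Nat.succ_eq_add_one] at this
  omega

structure Crit (α : ℕ → ℕ) (N K : ℕ) (W : ℕ → ℕ → ℕ) (p : ℕ × ℕ) : Prop where
  lt : p.2 + 1 < N
  neg : Bal α K W p.2 p.1 < 0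
  before : ∀ q, p.1 < q → ∀ j, j + 1 < N → 0 ≤ Bal α K W j q
  least : ∀ j, j < p.2 → 0 ≤ Bal α K W j p.1

lemma Crit.unique {α : ℕ → ℕ} {N K : ℕ} {W : ℕ → ℕ → ℕ} {p p' : ℕ × ℕ} (h : Crit α N K W p)
    (h' : Crit α N K W p') : p = p' := by
  have h1 : p.1 = p'.1 := by
    rcases lt_trichotomy p.1 p'.1 with h2 | h2 | h2
    · have := h.before _ h2 _ h'.lt
      have := h'.neg
      omega
    · exact h2
    · have := h'.before _ h2 _ h.lt
      have := h.neg
      omega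
  have h2 : p.2 = p'.2 := by
    have a1 := h.neg
    have a2 := h'.neg
    rcases lt_trichotomy p.2 p'.2 with h2 | h2 | h2
    · have := h'.least _ h2
      rw [← h1] at this
      omega
    · exact h2
    · have := h.least _ h2
      rw [h1] at this
      omega
  exact Prod.ext h1 h2

lemma Crit.exists {α : ℕ → ℕ} (hα : Antitone α) {N K : ℕ} (hK : 0 < K) {W : ℕ → ℕ → ℕ}
    (hA : Arr N K W) (hb : ¬ Good α N K W) : ∃ p, Crit α N K W p := by
  classical
  obtain ⟨Q, hQ⟩ := hA.bal_large hK α hα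
  unfold Good at hb
  push Not at hb
  obtain ⟨q0, i0, hi0, hq0⟩ := hb
  let P : ℕ → Prop := fun q => ∃ i, i + 1 < N ∧ Bal α K W i q < 0
  have hP0 : P q0 := ⟨i0, hi0, hq0⟩
  have hq0Q : q0 ≤ Q := by
    by_contra hc
    have := hQ q0 (by omega) i0 hi0
    omega
  have hPq : P (Nat.findGreatest P Q) := Nat.findGreatest_spec hq0Q hP0
  set q := Nat.findGreatest P Q with hq
  refine ⟨(q, Nat.find hPq), (Nat.find_spec hPq).1, (Nat.find_spec hPq).2, ?_, ?_⟩
  · intro q' hq' j hj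
    by_contra hc
    push Not at hc
    rcases le_or_gt q' Q with h1 | h1
    · have := Nat.le_findGreatest h1 (show P q' from ⟨j, hj, hc⟩)
      simp only at hq'
      omega
    · have := hQ q' h1.le j hj
      omega
  · intro j hj
    have h1 := Nat.find_min hPq hj
    by_contra hc
    push Not at hc
    have := (Nat.find_spec hPq).1
    simp only at hj hc
    exact h1 ⟨by omega, hc⟩

def updW (K : ℕ) (W : ℕ → ℕ → ℕ) (p : ℕ × ℕ) : ℕ → ℕ → ℕ :=
  Function.update W (p.2+1) (flipY K p.1 (W p.2) (W (p.2+1)) (W (p.2+2)))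

lemma updW_AA {α : ℕ → ℕ} {N K : ℕ} {W : ℕ → ℕ → ℕ} (hA : Arr N K W) {p : ℕ × ℕ}
    (h : Crit α N K W p) (q : ℕ) (hq : p.1 ≤ q) (t : ℕ) : AA K q (updW K W p t) = AA K q (W t) := by
  unfold updW
  by_cases ht : t = p.2 + 1
  · subst ht
    rw [Function.update_self, flip_AA (hA.tri _ h.lt) _ _ hq]
  · rw [Function.update_of_ne ht]

lemma updW_Bal {α : ℕ → ℕ} {N K : ℕ} {W : ℕ → ℕ → ℕ} (hA : Arr N K W) {p : ℕ × ℕ}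
    (h : Crit α N K W p) (q : ℕ) (hq : p.1 ≤ q) (j : ℕ) :
    Bal α K (updW K W p) j q = Bal α K W j q := by
  unfold Bal balt
  rw [updW_AA hA h q hq, updW_AA hA h q hq, updW_AA hA h q hq]

lemma updW_Crit {α : ℕ → ℕ} {N K : ℕ} {W : ℕ → ℕ → ℕ} (hA : Arr N K W) {p : ℕ × ℕ}
    (h : Crit α N K W p) : Crit α N K (updW K W p) p := by
  refine ⟨h.lt, ?_, ?_, ?_⟩
  · rw [updW_Bal hA h _ le_rfl]; exact h.neg
  · intro q hq j hj
    rw [updW_Bal hA h _ hq.le]; exact h.before q hq j hj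
  · intro j hj
    rw [updW_Bal hA h _ le_rfl]; exact h.least j hj

lemma updW_updW {α : ℕ → ℕ} {N K : ℕ} {W : ℕ → ℕ → ℕ} (hA : Arr N K W) {p : ℕ × ℕ}
    (h : Crit α N K W p) : updW K (updW K W p) p = W := by
  have h1 : updW K W p p.2 = W p.2 := Function.update_of_ne (by omega) _ _
  have h2 : updW K W p (p.2+2) = W (p.2+2) := Function.update_of_ne (by omega) _ _
  have h3 : updW K W p (p.2+1) = flipY K p.1 (W p.2) (W (p.2+1)) (W (p.2+2)) :=
    Function.update_self _ _ _
  rw [updW, h1, h2, h3, flipY_flipY (hA.tri _ h.lt), updW, Function.update_idem, Function.update_eq_self]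

lemma updW_il {α : ℕ → ℕ} {N K : ℕ} {W : ℕ → ℕ → ℕ} (hA : Arr N K W) {p : ℕ × ℕ}
    (h : Crit α N K W p) (s : ℕ) (hs : s < N) (e : ℕ) :
    updW K W p (s+1) (e+2) ≤ updW K W p s e ∧ updW K W p s e ≤ updW K W p (s+1) e := by
  have ht := flip_tri (hA.tri _ h.lt) p.1
  have h3 : updW K W p (p.2+1) = flipY K p.1 (W p.2) (W (p.2+1)) (W (p.2+2)) :=
    Function.update_self _ _ _
  have h4 : ∀ t, t ≠ p.2 + 1 → updW K W p t = W t := fun t ht => Function.update_of_ne ht _ _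
  by_cases h1 : s = p.2
  · subst h1
    rw [h3, h4 _ (by omega)]
    exact ht.xy e
  by_cases h2 : s = p.2 + 1
  · subst h2
    rw [h3, h4 _ (by omega)]
    exact ht.yz e
  · rw [h4 _ h2, h4 _ (by omega)]
    exact hA.il s hs e

lemma updW_alt {α : ℕ → ℕ} {N K : ℕ} (hK : 1 < K) {W : ℕ → ℕ → ℕ} (hA : Arr N K W) {p : ℕ × ℕ}
    (h : Crit α N K W p) :
    alt N (fun i => α i + rhoN N i + wtW K (updW K W p) i)
      = - alt N (fun i => α i + rhoN N i + wtW K W i) := by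
  have hT := hA.tri _ h.lt
  have hT' := flip_tri hT p.1
  have hs := flip_sum hK hT p.1 _ h.neg (fun q1 hq1 => h.before q1 hq1 _ h.lt)
  have h3 : updW K W p (p.2+1) = flipY K p.1 (W p.2) (W (p.2+1)) (W (p.2+2)) :=
    Function.update_self _ _ _
  have h4 : ∀ t, t ≠ p.2 + 1 → updW K W p t = W t := fun t ht => Function.update_of_ne ht _ _
  have hlt := h.lt
  have m1 : rsum K (W p.2) ≤ rsum K (W (p.2+1)) := Finset.sum_le_sum fun e _ => (hT.xy e).2
  have m2 : rsum K (W (p.2+1)) ≤ rsum K (W (p.2+2)) := Finset.sum_le_sum fun e _ => (hT.yz e).2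
  have m3 : rsum K (W p.2) ≤ rsum K (updW K W p (p.2+1)) := by
    rw [h3]; exact Finset.sum_le_sum fun e _ => (hT'.xy e).2
  have m4 : rsum K (updW K W p (p.2+1)) ≤ rsum K (W (p.2+2)) := by
    rw [h3]; exact Finset.sum_le_sum fun e _ => (hT'.yz e).2
  rw [← h3] at hs
  apply alt_swap N _ _ p.2 h.lt
  · simp only [wtW, rhoN]
    rw [h4 p.2 (by omega), show p.2 + 1 + 1 = p.2 + 2 by ring]
    omega
  · simp only [wtW, rhoN]
    rw [show p.2 + 1 + 1 = p.2 + 2 by ring, h4 (p.2+2) (by omega)]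
    omega
  · intro j hj1 hj2
    simp only [wtW]
    rw [h4 j hj2, h4 (j+1) (by omega)]

lemma PW_arr {k N : ℕ} {lam mu nu rho : ℕ → ℕ} (hlk : ∀ r, k ≤ r → lam r = 0)
    (hnk : ∀ r, k ≤ r → nu r = 0) {W : ℕ → ℕ → ℕ} (h : W ∈ PW k N lam mu nu rho) :
    Arr N (2 * k) W := by
  rw [mem_PW _ _ _ _ _ _ hlk hnk] at h
  refine ⟨h.2.2.2, ?_, h.1⟩
  intro e he
  rw [h.2.1]
  unfold il
  split_ifs
  · exact hlk _ (by omega)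
  · exact hnk _ (by omega)

lemma PW_upd {k N : ℕ} {lam mu nu rho : ℕ → ℕ} (hlk : ∀ r, k ≤ r → lam r = 0)
    (hnk : ∀ r, k ≤ r → nu r = 0) {W : ℕ → ℕ → ℕ} (h : W ∈ PW k N lam mu nu rho)
    {α : ℕ → ℕ} {p : ℕ × ℕ} (hp : Crit α N (2 * k) W p) :
    updW (2 * k) W p ∈ PW k N lam mu nu rho := by
  have hA := PW_arr hlk hnk h
  rw [mem_PW _ _ _ _ _ _ hlk hnk] at h ⊢
  have hlt := hp.lt
  have h4 : ∀ t, t ≠ p.2 + 1 → updW (2 * k) W p t = W t := fun t ht => Function.update_of_ne ht _ _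
  refine ⟨?_, ?_, ?_, updW_il hA hp⟩
  · intro s hs; rw [h4 _ (by omega)]; exact h.1 s hs
  · rw [h4 _ (by omega)]; exact h.2.1
  · rw [h4 _ (by omega)]; exact h.2.2.1

open Classical in
noncomputable def GW (α : ℕ → ℕ) (k N : ℕ) (lam mu nu rho : ℕ → ℕ) : Finset (ℕ → ℕ → ℕ) :=
  (PW k N lam mu nu rho).filter (Good α N (2 * k))

open Classical in
lemma bad_sum {k N : ℕ} (hk : 0 < k) {lam mu nu rho : ℕ → ℕ} (hlk : ∀ r, k ≤ r → lam r = 0)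
    (hnk : ∀ r, k ≤ r → nu r = 0) {α : ℕ → ℕ} (hα : Antitone α) :
    ∑ W ∈ (PW k N lam mu nu rho).filter (fun W => ¬ Good α N (2 * k) W),
      alt N (fun i => α i + rhoN N i + wtW (2 * k) W i) = 0 := by
  have hex : ∀ W ∈ (PW k N lam mu nu rho).filter (fun W => ¬ Good α N (2 * k) W),
      ∃ p, Crit α N (2 * k) W p := by
    intro W hW
    rw [mem_filter] at hW
    exact Crit.exists hα (by omega) (PW_arr hlk hnk hW.1) hW.2
  choose! p hp using hex
  have hneg : ∀ W ∈ (PW k N lam mu nu rho).filter (fun W => ¬ Good α N (2 * k) W),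
      alt N (fun i => α i + rhoN N i + wtW (2 * k) (updW (2 * k) W (p W)) i)
      = - alt N (fun i => α i + rhoN N i + wtW (2 * k) W i) := by
    intro W hW
    exact updW_alt (by omega) (PW_arr hlk hnk (mem_filter.mp hW).1) (hp W hW)
  have hmem : ∀ W ∈ (PW k N lam mu nu rho).filter (fun W => ¬ Good α N (2 * k) W),
      updW (2 * k) W (p W) ∈ (PW k N lam mu nu rho).filter (fun W => ¬ Good α N (2 * k) W) := by
    intro W hW
    have h1 := (mem_filter.mp hW).1
    rw [mem_filter]
    refine ⟨PW_upd hlk hnk h1 (hp W hW), ?_⟩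
    intro hg
    have h2 := updW_Crit (PW_arr hlk hnk h1) (hp W hW)
    have h3 := hg (p W).1 _ h2.lt
    have h4 := h2.neg
    omega
  refine Finset.sum_involution (fun W _ => updW (2 * k) W (p W)) ?_ ?_ hmem ?_
  · intro W hW
    rw [hneg W hW]; ring
  · intro W hW hne heq
    apply hne
    have h1 := hneg W hW
    rw [heq] at h1
    exact self_eq_neg.mp h1
  · intro W hW
    have h1 := (mem_filter.mp hW).1
    have h2 := updW_Crit (PW_arr hlk hnk h1) (hp W hW)
    have h3 := hp _ (hmem W hW)
    have h4 := h3.unique h2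
    simp only [h4]
    exact updW_updW (PW_arr hlk hnk h1) (hp W hW)

lemma good_expansion {k N : ℕ} (hk : 0 < k) {lam mu nu rho : ℕ → ℕ} (hl : Antitone lam) (hm : Antitone mu)
    (hlk : ∀ r, k ≤ r → lam r = 0) (hmk : ∀ r, k ≤ r → mu r = 0)
    (hn : Antitone nu) (hr : Antitone rho)
    (hnk : ∀ r, k ≤ r → nu r = 0) (hrk : ∀ r, k ≤ r → rho r = 0)
    {α : ℕ → ℕ} (hα : Antitone α) :
    Sf N α * (skewSchur N k lam mu * skewSchur N k nu rho)
      = ∑ W ∈ GW α k N lam mu nu rho, Sf N (fun i => α i + wtW (2 * k) W i) := by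
  classical
  apply mul_right_cancel₀ (alt_rho_ne N)
  have h1 := alt_mul N (fun i => α i + rhoN N i) (skewSchur N k lam mu * skewSchur N k nu rho)
    (by intro σ; rw [map_mul, skewSchur_rename, skewSchur_rename])
    (PW k N lam mu nu rho) (wtW (2 * k))
    (pair_eq_sum N k lam mu nu rho hl hm hlk hmk hn hr hnk hrk)
  rw [← Finset.sum_filter_add_sum_filter_not _ (Good α N (2 * k)), bad_sum hk hlk hnk hα,
    add_zero, alt_Sf] at h1
  rw [mul_right_comm, h1, GW, Finset.sum_mul]
  apply Finset.sum_congr (by congr)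
  intro W _
  rw [← alt_Sf]
  congr 1
  funext i
  ring

lemma good_dominant {α : ℕ → ℕ} {N K : ℕ} (hK : 0 < K) {W : ℕ → ℕ → ℕ} (hA : Arr N K W)
    (hg : Good α N K W) (hαN : ∀ j, N ≤ j → α j = 0) :
    Antitone (fun i => α i + wtW K W i) ∧ ∀ j, N ≤ j → α j + wtW K W j = 0 := by
  have hz : ∀ j, N ≤ j → α j + wtW K W j = 0 := by
    intro j hj
    rw [hαN j hj, wtW, hA.out (j+1) (by omega)]
    simp [rsum]
  refine ⟨antitone_nat_of_succ_le ?_, hz⟩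
  intro i
  rcases lt_or_ge (i+1) N with h1 | h1
  · have h2 := hg 0 i h1
    have h3 : ∀ f, AA K 0 f = rsum K f := by
      intro f
      unfold AA rsum
      rw [Nat.cast_sum]
      apply Finset.sum_congr rfl
      intro e he
      rw [mem_range] at he
      rw [zero_add, Nat.div_eq_of_lt he, Nat.sub_zero]
    unfold Bal balt at h2
    rw [h3, h3, h3] at h2
    have hT := hA.tri i h1
    have m1 : rsum K (W i) ≤ rsum K (W (i+1)) := Finset.sum_le_sum fun e _ => (hT.xy e).2
    have m2 : rsum K (W (i+1)) ≤ rsum K (W (i+2)) := Finset.sum_le_sum fun e _ => (hT.yz e).2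
    simp only [wtW]
    rw [show i + 1 + 1 = i + 2 by ring]
    omega
  · have := hz (i+1) h1
    show α (i+1) + wtW K W (i+1) ≤ α i + wtW K W i
    omega


lemma sum_pairs {M : Type*} [AddCommMonoid M] (k : ℕ) (g : ℕ → M) :
    ∑ e ∈ range (2 * k), g e = ∑ r ∈ range k, (g (2 * r) + g (2 * r + 1)) := by
  induction k with
  | zero => simp
  | succ k ih =>
    rw [show 2 * (k + 1) = 2 * k + 1 + 1 by ring, sum_range_succ, sum_range_succ, ih,
      sum_range_succ, add_assoc]

/-- same unordered pair in each row -/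
def SameP (f g : ℕ → ℕ) : Prop :=
  ∀ r, max (f (2 * r)) (f (2 * r + 1)) = max (g (2 * r)) (g (2 * r + 1)) ∧
    min (f (2 * r)) (f (2 * r + 1)) = min (g (2 * r)) (g (2 * r + 1))

lemma SameP.rsum {f g : ℕ → ℕ} (h : SameP f g) (k : ℕ) : rsum (2 * k) f = rsum (2 * k) g := by
  unfold _root_.rsum
  rw [sum_pairs, sum_pairs]
  apply Finset.sum_congr rfl
  intro r _
  have := h r
  omega

lemma SameP.AA {f g : ℕ → ℕ} (h : SameP f g) (k u : ℕ) : AA (2 * k) (2 * u) f = AA (2 * k) (2 * u) g := by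
  unfold _root_.AA
  rw [sum_pairs, sum_pairs]
  apply Finset.sum_congr rfl
  intro r _
  have h1 := h r
  have h2 : (2 * u + (2 * r + 1)) / (2 * k) = (2 * u + 2 * r) / (2 * k) := by
    rw [← Nat.div_div_eq_div_mul, ← Nat.div_div_eq_div_mul]
    congr 1
    omega
  rw [h2]
  omega

lemma balt_diff {K q e m : ℕ} (he : e < K) (hm : K * (m + 1) = q + 1 + e) (X Y Z : ℕ → ℕ) :
    balt K q X Y Z = balt K (q+1) X Y Z + (bterm X Y Z m e - bterm X Y Z (m+1) e) := by
  have hK : 0 < K := by omega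
  have hmul : K * (m + 1) = K * m + K := by ring
  have hmul2 : K * (m + 2) = K * m + K + K := by ring
  have key : ∑ f ∈ range K, (bterm X Y Z ((q + f) / K) f - bterm X Y Z ((q + 1 + f) / K) f)
      = bterm X Y Z m e - bterm X Y Z (m+1) e := by
    rw [Finset.sum_eq_single e]
    · have a1 : (q + e) / K = m := le_antisymm (dv_ge hK (by omega)) (dv_le hK (by omega))
      have a2 : (q + 1 + e) / K = m + 1 := le_antisymm (dv_ge hK (by omega)) (dv_le hK (by omega))
      rw [a1, a2]
    · intro f hf hne
      rw [mem_range] at hf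
      have : (q + f) / K = (q + 1 + f) / K := by
        rcases lt_or_gt_of_ne hne with h2 | h2
        · trans m
          · exact le_antisymm (dv_ge hK (by omega)) (dv_le hK (by omega))
          · exact (le_antisymm (dv_ge hK (by omega)) (dv_le hK (by omega))).symm
        · trans m + 1
          · exact le_antisymm (dv_ge hK (by omega)) (dv_le hK (by omega))
          · exact (le_antisymm (dv_ge hK (by omega)) (dv_le hK (by omega))).symm
      rw [this, sub_self]
    · intro h; exact absurd (mem_range.mpr he) h
  rw [Finset.sum_sub_distrib, ← balt_eq, ← balt_eq] at key
  omega

def partner (e : ℕ) : ℕ := if e % 2 = 0 then e + 1 else e - 1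

def Phi (W0 W : ℕ → ℕ → ℕ) : ℕ → ℕ → ℕ := fun t e =>
  if W0 t (2 * (e / 2) + 1) ≤ W0 t (2 * (e / 2)) then W t e else W t (partner e)

lemma Phi_even (W0 W : ℕ → ℕ → ℕ) (t r : ℕ) :
    Phi W0 W t (2 * r) = if W0 t (2 * r + 1) ≤ W0 t (2 * r) then W t (2 * r) else W t (2 * r + 1) := by
  unfold Phi partner
  rw [show 2 * r / 2 = r by omega, if_pos (show 2 * r % 2 = 0 by omega)]

lemma Phi_odd (W0 W : ℕ → ℕ → ℕ) (t r : ℕ) :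
    Phi W0 W t (2 * r + 1) = if W0 t (2 * r + 1) ≤ W0 t (2 * r) then W t (2 * r + 1) else W t (2 * r) := by
  unfold Phi partner
  rw [show (2 * r + 1) / 2 = r by omega, if_neg (show ¬ (2 * r + 1) % 2 = 0 by omega),
    show 2 * r + 1 - 1 = 2 * r by omega]

lemma even_odd_cases (P : ℕ → Prop) (h0 : ∀ r, P (2 * r)) (h1 : ∀ r, P (2 * r + 1)) (e : ℕ) : P e := by
  rcases Nat.even_or_odd' e with ⟨r, rfl | rfl⟩
  · exact h0 r
  · exact h1 r

lemma Phi_Phi (W0 W : ℕ → ℕ → ℕ) : Phi W0 (Phi W0 W) = W := by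
  funext t e
  revert e
  apply even_odd_cases
  · intro r
    rw [Phi_even, Phi_even, Phi_odd]; split_ifs <;> rfl
  · intro r
    rw [Phi_odd, Phi_even, Phi_odd]; split_ifs <;> rfl

lemma Phi_same (W0 W : ℕ → ℕ → ℕ) (t : ℕ) : SameP (Phi W0 W t) (W t) := by
  intro r
  rw [Phi_even, Phi_odd]
  split_ifs
  · exact ⟨rfl, rfl⟩
  · exact ⟨max_comm _ _, min_comm _ _⟩

lemma Phi_il {N K : ℕ} {W0 W : ℕ → ℕ → ℕ} (h0 : Arr N K W0) (h : Arr N K W)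
    (hs : ∀ t, SameP (W t) (W0 t)) (s : ℕ) (hsN : s < N) (e : ℕ) :
    Phi W0 W (s+1) (e+2) ≤ Phi W0 W s e ∧ Phi W0 W s e ≤ Phi W0 W (s+1) e := by
  have aux : ∀ r, (Phi W0 W (s+1) (2*r+2) ≤ Phi W0 W s (2*r) ∧ Phi W0 W s (2*r) ≤ Phi W0 W (s+1) (2*r)) ∧
      (Phi W0 W (s+1) (2*r+1+2) ≤ Phi W0 W s (2*r+1) ∧ Phi W0 W s (2*r+1) ≤ Phi W0 W (s+1) (2*r+1)) := by
    intro r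
    have e1 : 2 * r + 2 = 2 * (r + 1) := by ring
    have e2 : 2 * r + 1 + 2 = 2 * (r + 1) + 1 := by ring
    have a1 := h.il s hsN (2*r)
    have a2 := h.il s hsN (2*r+1)
    have b1 := h0.il s hsN (2*r)
    have b2 := h0.il s hsN (2*r+1)
    rw [e1] at a1 b1
    rw [e2] at a2 b2
    have c1 := hs s r
    have c2 := hs (s+1) r
    have c3 := hs (s+1) (r+1)
    rw [e1, e2]
    rw [Phi_even, Phi_even, Phi_odd, Phi_odd, Phi_even, Phi_odd]
    refine ⟨⟨?_, ?_⟩, ⟨?_, ?_⟩⟩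
    · split_ifs <;> omega
    · split_ifs <;> omega
    · split_ifs <;> omega
    · split_ifs <;> omega
  revert e
  apply even_odd_cases
  · intro r; exact (aux r).1
  · intro r; exact (aux r).2

/-- the case check behind goodness of `Phi` -/
lemma phi_cell (c xT xU yT yU zT zU yT0 yU0 zT0 zU0 : ℕ)
    (h1 : xT ≤ yT) (h2 : xU ≤ yU) (h3 : yT ≤ zT) (h4 : yU ≤ zU) (h5 : yT0 ≤ zT0) (h6 : yU0 ≤ zU0)
    (sy : max yT yU = max yT0 yU0) (sy' : min yT yU = min yT0 yU0)
    (sz : max zT zU = max zT0 zU0) (sz' : min zT zU = min zT0 zU0)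
    (hT : ¬ (yT < c ∧ c ≤ zT)) (hT0 : ¬ (yT0 < c ∧ c ≤ zT0))
    (hU : (yU < c ∧ c ≤ zU) → (c ≤ yT ∧ xT < c))
    (h7 : (if yU0 ≤ yT0 then yT else yU) < c) (h8 : c ≤ (if zU0 ≤ zT0 then zT else zU)) : False := by
  split_ifs at h7 h8 <;> omega

lemma Phi_good {N k : ℕ} (hk : 0 < k) {W0 W : ℕ → ℕ → ℕ} {α : ℕ → ℕ} (h0 : Arr N (2 * k) W0) (h : Arr N (2 * k) W)
    (hs : ∀ t, SameP (W t) (W0 t)) (g0 : Good α N (2 * k) W0) (g : Good α N (2 * k) W) :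
    Good α N (2 * k) (Phi W0 W) := by
  have heven : ∀ u i, Bal α (2 * k) (Phi W0 W) i (2 * u) = Bal α (2 * k) W i (2 * u) := by
    intro u i
    unfold Bal balt
    rw [(Phi_same W0 W _).AA, (Phi_same W0 W _).AA, (Phi_same W0 W _).AA]
  have heven0 : ∀ u i, Bal α (2 * k) W0 i (2 * u) = Bal α (2 * k) W i (2 * u) := by
    intro u i
    unfold Bal balt
    rw [(hs _).AA, (hs _).AA, (hs _).AA]
  intro q i hi
  rcases Nat.even_or_odd' q with ⟨u, rfl | rfl⟩
  · rw [heven]; exact g _ _ hi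
  -- odd position
  have hK : 0 < 2 * k := by omega
  obtain ⟨r, m, hr, hm⟩ : ∃ r m, r < k ∧ k * (m + 1) = u + 1 + r := by
    have hsp := dv_spec hk u
    have hmul : k * (u / k + 1) = k * (u / k) + k := by ring
    exact ⟨k * (u / k + 1) - (u + 1), u / k, by omega, by omega⟩
  have hm2 : 2 * k * (m + 1) = 2 * u + 2 + 2 * r := by
    rw [mul_assoc, hm]; ring
  have d1 := fun (X Y Z : ℕ → ℕ) => balt_diff (K := 2 * k) (q := 2 * u + 1) (e := 2 * r) (m := m)
    (by omega) (by omega) X Y Z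
  have d2 := fun (X Y Z : ℕ → ℕ) => balt_diff (K := 2 * k) (q := 2 * u) (e := 2 * r + 1) (m := m)
    (by omega) (by omega) X Y Z
  have T := h.tri i hi
  have T0 := h0.tri i hi
  have hA' : Arr N (2 * k) (Phi W0 W) := by
    refine ⟨Phi_il h0 h hs, ?_, ?_⟩
    · intro e he
      unfold Phi
      split_ifs
      · exact h.zero _ _ he
      · exact h.zero _ _ (by unfold partner; split_ifs <;> omega)
    · intro s hsN
      funext e
      unfold Phi
      rw [h.out s hsN]; simp
  have T' := hA'.tri i hi
  have B2 := heven (u+1) i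
  have B20 := heven0 (u+1) i
  have G2 := g (2 * (u + 1)) i hi
  have G1 := g (2 * u + 1) i hi
  have G0 := g (2 * u) i hi
  have G10 := g0 (2 * u + 1) i hi
  rw [show 2 * (u + 1) = 2 * u + 1 + 1 by ring] at B2 B20 G2
  unfold Bal at B2 B20 G2 G1 G0 G10 ⊢
  rw [d2] at G0
  rw [d1] at G0 G1 G10 ⊢
  have st := bstep T' m (2 * r)
  by_contra hc
  push Not at hc
  have hneg : bterm (Phi W0 W i) (Phi W0 W (i+1)) (Phi W0 W (i+2)) m (2 * r)
      - bterm (Phi W0 W i) (Phi W0 W (i+1)) (Phi W0 W (i+2)) (m+1) (2 * r) < 0 := by omega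
  have hy := st.2 hneg
  have hT : 0 ≤ bterm (W i) (W (i+1)) (W (i+2)) m (2 * r)
      - bterm (W i) (W (i+1)) (W (i+2)) (m+1) (2 * r) := by omega
  have hT0 : 0 ≤ bterm (W0 i) (W0 (i+1)) (W0 (i+2)) m (2 * r)
      - bterm (W0 i) (W0 (i+1)) (W0 (i+2)) (m+1) (2 * r) := by omega
  have hTU : 0 ≤ (bterm (W i) (W (i+1)) (W (i+2)) m (2 * r)
      - bterm (W i) (W (i+1)) (W (i+2)) (m+1) (2 * r)) + (bterm (W i) (W (i+1)) (W (i+2)) m (2 * r + 1)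
      - bterm (W i) (W (i+1)) (W (i+2)) (m+1) (2 * r + 1)) := by omega
  clear G0 G1 G10 G2 B2 B20 hc hneg st d1 d2
  rw [Phi_even, Phi_even] at hy
  have x1 := (T.xy (2 * r)).2
  have x2 := (T.xy (2 * r + 1)).2
  have x3 := (T.yz (2 * r)).2
  have x4 := (T.yz (2 * r + 1)).2
  have x5 := (T0.xy (2 * r)).2
  have x6 := (T0.yz (2 * r)).2
  have x7 := (T0.yz (2 * r + 1)).2
  refine phi_cell (m+1) _ _ _ _ _ _ _ _ _ _ x1 x2 x3 x4 x6 x7 (hs (i+1) r).1 (hs (i+1) r).2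
    (hs (i+2) r).1 (hs (i+2) r).2 ?_ ?_ ?_ hy.1 hy.2
  · unfold bterm at hT; omega
  · unfold bterm at hT0; omega
  · unfold bterm at hTU hT; omega

def SNgen (N : ℕ) : Set (MvPolynomial (Fin N) ℤ) :=
  {f | ∃ β : ℕ → ℕ, Antitone β ∧ (∀ j, N ≤ j → β j = 0) ∧ f = Sf N β}

noncomputable def SN (N : ℕ) : AddSubmonoid (MvPolynomial (Fin N) ℤ) := AddSubmonoid.closure (SNgen N)

def vmax (a b : ℕ → ℕ) : ℕ → ℕ := fun r => max (a r) (b r)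
def vmin (a b : ℕ → ℕ) : ℕ → ℕ := fun r => min (a r) (b r)

lemma vmax_anti {a b : ℕ → ℕ} (ha : Antitone a) (hb : Antitone b) : Antitone (vmax a b) :=
  fun _ _ h => max_le_max (ha h) (hb h)
lemma vmin_anti {a b : ℕ → ℕ} (ha : Antitone a) (hb : Antitone b) : Antitone (vmin a b) :=
  fun _ _ h => min_le_min (ha h) (hb h)

section compare
variable {k N : ℕ} {lam mu nu rho : ℕ → ℕ}

lemma gen_mul_pair
    (hk : 0 < k) (hl : Antitone lam) (hm : Antitone mu) (hlk : ∀ r, k ≤ r → lam r = 0) (hmk : ∀ r, k ≤ r → mu r = 0) (hn : Antitone nu) (hr : Antitone rho) (hnk : ∀ r, k ≤ r → nu r = 0) (hrk : ∀ r, k ≤ r → rho r = 0) {g : MvPolynomial (Fin N) ℤ} (hg : g ∈ SNgen N) :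
    g * (skewSchur N k lam mu * skewSchur N k nu rho) ∈ SN N := by
  classical
  obtain ⟨α, hα, hαN, rfl⟩ := hg
  rw [good_expansion hk hl hm hlk hmk hn hr hnk hrk hα]
  apply AddSubmonoid.sum_mem
  intro W hW
  apply AddSubmonoid.subset_closure
  rw [GW, mem_filter] at hW
  have := good_dominant (by omega) (PW_arr hlk hnk hW.1) hW.2 hαN
  exact ⟨_, this.1, this.2, rfl⟩

lemma Phi_mem
    (hk : 0 < k) (hlk : ∀ r, k ≤ r → lam r = 0) (hnk : ∀ r, k ≤ r → nu r = 0) {α : ℕ → ℕ} {W0 W : ℕ → ℕ → ℕ} (h0 : W0 ∈ GW α k N lam mu nu rho)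
    (h : W ∈ GW α k N lam mu nu rho) (hs : ∀ t, SameP (W t) (W0 t)) :
    Phi W0 W ∈ GW α k N (vmax lam nu) (vmax mu rho) (vmin lam nu) (vmin mu rho) := by
  classical
  rw [GW, mem_filter] at h0 h ⊢
  have A0 := PW_arr hlk hnk h0.1
  have A := PW_arr hlk hnk h.1
  refine ⟨?_, Phi_good hk A0 A hs h0.2 h.2⟩
  have a0 := (mem_PW _ _ _ _ _ _ hlk hnk _).mp h0.1
  have a := (mem_PW _ _ _ _ _ _ hlk hnk _).mp h.1
  rw [mem_PW _ _ _ _ _ _ (fun r hr => by simp [vmax, hlk r hr, hnk r hr])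
    (fun r hr => by simp [vmin, hlk r hr])]
  have hbd : ∀ t (f g : ℕ → ℕ), W0 t = il f g → W t = il f g → Phi W0 W t = il (vmax f g) (vmin f g) := by
    intro t f g h1 h2
    funext e
    revert e
    apply even_odd_cases
    · intro r
      rw [Phi_even, h1, h2, il_even, il_odd, il_even, vmax]
      split_ifs <;> omega
    · intro r
      rw [Phi_odd, h1, h2, il_even, il_odd, il_odd, vmin]
      split_ifs <;> omega
  refine ⟨?_, hbd N _ _ a0.2.1 a.2.1, hbd 0 _ _ a0.2.2.1 a.2.2.1, Phi_il A0 A hs⟩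
  intro s hsN
  funext e
  unfold Phi
  rw [A.out s hsN]; simp

lemma gen_mul_diff
    (hk : 0 < k) (hl : Antitone lam) (hm : Antitone mu) (hlk : ∀ r, k ≤ r → lam r = 0) (hmk : ∀ r, k ≤ r → mu r = 0) (hn : Antitone nu) (hr : Antitone rho) (hnk : ∀ r, k ≤ r → nu r = 0) (hrk : ∀ r, k ≤ r → rho r = 0) {g : MvPolynomial (Fin N) ℤ} (hg : g ∈ SNgen N) :
    g * (skewSchur N k (vmax lam nu) (vmax mu rho) * skewSchur N k (vmin lam nu) (vmin mu rho)
      - skewSchur N k lam mu * skewSchur N k nu rho) ∈ SN N := by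
  classical
  obtain ⟨α, hα, hαN, rfl⟩ := hg
  have hxk : ∀ r, k ≤ r → vmax lam nu r = 0 := fun r hr => by simp [vmax, hlk r hr, hnk r hr]
  have hik : ∀ r, k ≤ r → vmin lam nu r = 0 := fun r hr => by simp [vmin, hlk r hr]
  rw [mul_sub, good_expansion hk hl hm hlk hmk hn hr hnk hrk hα,
    good_expansion hk (vmax_anti hl hn) (vmax_anti hm hr) hxk
      (fun r hr => by simp [vmax, hmk r hr, hrk r hr])
      (vmin_anti hl hn) (vmin_anti hm hr) hik
      (fun r hr => by simp [vmin, hmk r hr]) hα]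
  let cls : (ℕ → ℕ → ℕ) → (ℕ → ℕ → ℕ × ℕ) := fun W t r =>
    (max (W t (2 * r)) (W t (2 * r + 1)), min (W t (2 * r)) (W t (2 * r + 1)))
  have hcls : ∀ W W', cls W = cls W' → ∀ t, SameP (W t) (W' t) := by
    intro W W' h t r
    have := congrFun (congrFun h t) r
    exact Prod.mk.injEq _ _ _ _ ▸ this
  have hcls' : ∀ W W', (∀ t, SameP (W t) (W' t)) → cls W = cls W' := by
    intro W W' h
    funext t r
    exact Prod.ext (h t r).1 (h t r).2
  set S : Finset (ℕ → ℕ → ℕ) := GW α k N lam mu nu rho with hS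
  set S' := GW α k N (vmax lam nu) (vmax mu rho) (vmin lam nu) (vmin mu rho) with hS'
  let rep : (ℕ → ℕ → ℕ) → (ℕ → ℕ → ℕ) := fun W => Function.invFunOn cls (↑S) (cls W)
  have hrep : ∀ W ∈ S, rep W ∈ S ∧ cls (rep W) = cls W := by
    intro W hW
    have hex : ∃ a ∈ (↑S : Set (ℕ → ℕ → ℕ)), cls a = cls W := ⟨W, hW, rfl⟩
    exact ⟨Function.invFunOn_mem hex, Function.invFunOn_eq hex⟩
  let F : (ℕ → ℕ → ℕ) → (ℕ → ℕ → ℕ) := fun W => Phi (rep W) W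
  have hF : ∀ W ∈ S, F W ∈ S' := fun W hW =>
    Phi_mem hk hlk hnk (hrep W hW).1 hW (hcls _ _ (hrep W hW).2.symm)
  have hFc : ∀ W, cls (F W) = cls W := fun W => hcls' _ _ (Phi_same _ _)
  have hinj : Set.InjOn F ↑S := by
    intro W hW W' hW' hFF
    have h1 : cls W = cls W' := by rw [← hFc W, ← hFc W', hFF]
    have h2 : rep W = rep W' := by simp only [rep, h1]
    have h3 : Phi (rep W) (F W) = W := Phi_Phi _ _
    have h4 : Phi (rep W') (F W') = W' := Phi_Phi _ _
    rw [← h3, ← h4, hFF, h2]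
  have hwt : ∀ W, wtW (2 * k) (F W) = wtW (2 * k) W := by
    intro W
    funext i
    unfold wtW
    rw [(Phi_same (rep W) W _).rsum, (Phi_same (rep W) W _).rsum]
  have h1 : ∑ W ∈ S, Sf N (fun i => α i + wtW (2 * k) W i)
      = ∑ W ∈ S.image F, Sf N (fun i => α i + wtW (2 * k) W i) := by
    rw [Finset.sum_image hinj]
    simp only [hwt]
  rw [h1, ← Finset.sum_sdiff (Finset.image_subset_iff.mpr hF), add_sub_cancel_right]
  apply AddSubmonoid.sum_mem
  intro W hW
  apply AddSubmonoid.subset_closure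
  have hW' := (mem_sdiff.mp hW).1
  rw [hS', GW, mem_filter] at hW'
  have := good_dominant (by omega) (PW_arr hxk hik hW'.1) hW'.2 hαN
  exact ⟨_, this.1, this.2, rfl⟩

lemma SN_mul_of_gen {f : MvPolynomial (Fin N) ℤ} (hf : ∀ g ∈ SNgen N, g * f ∈ SN N)
    {g : MvPolynomial (Fin N) ℤ} (hg : g ∈ SN N) : g * f ∈ SN N := by
  unfold SN at hg
  induction hg using AddSubmonoid.closure_induction with
  | mem x hx => exact hf x hx
  | zero => rw [zero_mul]; exact AddSubmonoid.zero_mem _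
  | add x y _ _ hx hy => rw [add_mul]; exact AddSubmonoid.add_mem _ hx hy

lemma SN_mul_diff
    (hk : 0 < k) (hl : Antitone lam) (hm : Antitone mu) (hlk : ∀ r, k ≤ r → lam r = 0) (hmk : ∀ r, k ≤ r → mu r = 0) (hn : Antitone nu) (hr : Antitone rho) (hnk : ∀ r, k ≤ r → nu r = 0) (hrk : ∀ r, k ≤ r → rho r = 0) {g : MvPolynomial (Fin N) ℤ} (hg : g ∈ SN N) :
    g * (skewSchur N k (vmax lam nu) (vmax mu rho) * skewSchur N k (vmin lam nu) (vmin mu rho)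
      - skewSchur N k lam mu * skewSchur N k nu rho) ∈ SN N :=
  SN_mul_of_gen (fun _ h => gen_mul_diff hk hl hm hlk hmk hn hr hnk hrk h) hg

lemma SN_mul_skew
    (hk : 0 < k) (hl : Antitone lam) (hm : Antitone mu) (hlk : ∀ r, k ≤ r → lam r = 0) (hmk : ∀ r, k ≤ r → mu r = 0) {g : MvPolynomial (Fin N) ℤ} (hg : g ∈ SN N) :
    g * skewSchur N k lam mu ∈ SN N := by
  have h := SN_mul_of_gen (fun _ h => gen_mul_pair (N := N) hk hl hm hlk hmk
    (antitone_const (c := 0)) (antitone_const (c := 0)) (fun _ _ => rfl) (fun _ _ => rfl) h) hg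
  rwa [skewSchur_zero, mul_one] at h
end compare

lemma SN_one (N : ℕ) : (1 : MvPolynomial (Fin N) ℤ) ∈ SN N := by
  apply AddSubmonoid.subset_closure
  exact ⟨fun _ => 0, antitone_const, fun _ _ => rfl, (skewSchur_zero N N).symm⟩

lemma SN_nonneg {N : ℕ} {f : MvPolynomial (Fin N) ℤ} (hf : f ∈ SN N) : IsSchurNonneg N f := by
  unfold SN at hf
  induction hf using AddSubmonoid.closure_induction with
  | mem x hx =>
    obtain ⟨β, h1, h2, rfl⟩ := hx
    exact ⟨1, fun _ => 1, fun _ => N, fun _ => β, fun _ => h1, fun _ => h2, by simp [Sf]⟩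
  | zero => exact ⟨0, fun _ => 0, fun _ => 0, fun _ _ => 0, by simp, by simp, by simp⟩
  | add x y _ _ hx hy =>
    obtain ⟨m1, c1, k1, l1, a1, b1, e1⟩ := hx
    obtain ⟨m2, c2, k2, l2, a2, b2, e2⟩ := hy
    refine ⟨m1 + m2, Fin.append c1 c2, Fin.append k1 k2, Fin.append l1 l2, ?_, ?_, ?_⟩
    · intro i
      refine Fin.addCases (fun i => ?_) (fun i => ?_) i
      · rw [Fin.append_left]; exact a1 i
      · rw [Fin.append_right]; exact a2 i
    · intro i
      refine Fin.addCases (fun i => ?_) (fun i => ?_) i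
      · rw [Fin.append_left, Fin.append_left]; exact b1 i
      · rw [Fin.append_right, Fin.append_right]; exact b2 i
    · rw [Fin.sum_univ_add]
      simp only [Fin.append_left, Fin.append_right]
      rw [← e1, ← e2]


/-! Part VIII: padding, and the reduction of `n` shapes to pairs of shapes. -/

def ncons (L : ℕ) (v : ℕ → ℕ) : ℕ → ℕ
  | 0 => L
  | r + 1 => v r

lemma homog_neg (N : ℕ) {m : ℤ} (h : m < 0) : homog N m = 0 := by
  simp [homog, not_le.mpr h]

lemma homog_zero (N : ℕ) : homog N 0 = 1 := by
  simp [homog]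

lemma pad_last (N k : ℕ) (lam mu : ℕ → ℕ) (h1 : lam k = 0) (h2 : mu k = 0) :
    skewSchur N (k + 1) lam mu = skewSchur N k lam mu := by
  unfold skewSchur
  rw [Matrix.det_succ_row _ (Fin.last k), Finset.sum_eq_single (Fin.last k)]
  · simp only [Matrix.of_apply, Fin.val_last, h1, h2]
    rw [show ((0 : ℕ) : ℤ) - ((0 : ℕ) : ℤ) - (k : ℤ) + (k : ℤ) = 0 by simp, homog_zero,
      ← two_mul, pow_mul]
    simp only [neg_one_sq, one_pow, one_mul]
    congr 1
    ext i j : 2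
    simp
  · intro j _ hj
    have : (j : ℕ) < k := by
      have := j.2
      have : (j : ℕ) ≠ k := fun h => hj (Fin.ext h)
      omega
    simp only [Matrix.of_apply, Fin.val_last, h1]
    rw [homog_neg N (by push_cast; omega)]
    simp
  · simp

lemma pad_first (N k L : ℕ) (nu rho : ℕ → ℕ) (h : ∀ r, nu r ≤ L) :
    skewSchur N (k + 1) (ncons L nu) (ncons L rho) = skewSchur N k nu rho := by
  unfold skewSchur
  rw [Matrix.det_succ_column_zero, Finset.sum_eq_single 0]
  · simp only [Matrix.of_apply, Fin.val_zero, ncons, pow_zero, one_mul]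
    rw [show (L : ℤ) - (L : ℤ) - ((0 : ℕ) : ℤ) + ((0 : ℕ) : ℤ) = 0 by simp, homog_zero, one_mul]
    congr 1
    refine Matrix.ext fun i j => ?_
    simp only [Matrix.submatrix_apply, Matrix.of_apply, Fin.succAbove_zero, Fin.val_succ]
    show homog N ((nu i : ℤ) - (rho j : ℤ) - ((i + 1 : ℕ) : ℤ) + ((j + 1 : ℕ) : ℤ))
      = homog N ((nu i : ℤ) - (rho j : ℤ) - (i : ℤ) + (j : ℤ))
    congr 1
    push_cast
    ring
  · intro j _ hj
    obtain ⟨i, rfl⟩ := Fin.exists_succ_eq.mpr hj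
    simp only [Matrix.of_apply, Fin.val_succ, Fin.val_zero, ncons]
    have := h i
    rw [homog_neg N (by push_cast; omega)]
    simp
  · simp

/-- the shifted maximum -/
def smax (u v : ℕ → ℕ) : ℕ → ℕ := fun r => max (v r) (u (r + 1))
/-- the shifted minimum -/
def smin (u v : ℕ → ℕ) : ℕ → ℕ := ncons (u 0) (fun r => min (v r) (u (r + 1)))

lemma ncons_anti {L : ℕ} {v : ℕ → ℕ} (hv : Antitone v) (h : v 0 ≤ L) : Antitone (ncons L v) := by
  apply antitone_nat_of_succ_le
  intro r
  cases r with
  | zero => exact h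
  | succ r => exact hv (Nat.le_succ r)

lemma smax_anti {u v : ℕ → ℕ} (hu : Antitone u) (hv : Antitone v) : Antitone (smax u v) :=
  fun _ _ h => max_le_max (hv h) (hu (by omega))

lemma smin_anti {u v : ℕ → ℕ} (hu : Antitone u) (hv : Antitone v) : Antitone (smin u v) := by
  apply ncons_anti
  · exact fun _ _ h => min_le_min (hv h) (hu (by omega))
  · exact (min_le_right _ _).trans (hu (by omega))

lemma vmax_ncons {L : ℕ} {u v : ℕ → ℕ} (h : u 0 ≤ L) : vmax (ncons L v) u = ncons L (smax u v) := by
  funext r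
  cases r with
  | zero => exact max_eq_left h
  | succ r => rfl

lemma vmin_ncons {L : ℕ} {u v : ℕ → ℕ} (h : u 0 ≤ L) : vmin (ncons L v) u = smin u v := by
  funext r
  cases r with
  | zero => exact min_eq_right h
  | succ r => rfl

lemma SN_mul_shift {N k : ℕ} {l1 l2 m1 m2 : ℕ → ℕ}
    (a1 : Antitone l1) (a2 : Antitone l2) (b1 : Antitone m1) (b2 : Antitone m2)
    (z1 : ∀ r, k ≤ r → l1 r = 0) (z2 : ∀ r, k ≤ r → l2 r = 0)
    (y1 : ∀ r, k ≤ r → m1 r = 0) (y2 : ∀ r, k ≤ r → m2 r = 0)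
    {g : MvPolynomial (Fin N) ℤ} (hg : g ∈ SN N) :
    g * (skewSchur N k (smin l1 l2) (smin m1 m2) * skewSchur N k (smax l1 l2) (smax m1 m2)
      - skewSchur N k l1 m1 * skewSchur N k l2 m2) ∈ SN N := by
  obtain ⟨L, hL⟩ : ∃ L, L = l1 0 + l2 0 + m1 0 + m2 0 := ⟨_, rfl⟩
  have zc : ∀ v : ℕ → ℕ, (∀ r, k ≤ r → v r = 0) → ∀ r, k + 1 ≤ r → ncons L v r = 0 := by
    intro v hv r hr
    cases r with
    | zero => omega
    | succ r => exact hv r (by omega)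
  have zs : ∀ u v : ℕ → ℕ, (∀ r, k ≤ r → u r = 0) → (∀ r, k ≤ r → v r = 0) →
      (k = 0 → u 0 = 0) → smin u v k = 0 := by
    intro u v hu hv h0
    rcases k with _ | k
    · exact h0 rfl
    · show min _ _ = 0
      rw [hu _ le_rfl]; simp
  have h := SN_mul_diff (N := N) (Nat.succ_pos k) (ncons_anti (L := L) a2 (by omega))
    (ncons_anti (L := L) b2 (by omega)) (zc _ z2) (zc _ y2) a1 b1
    (fun r hr => z1 r (by omega)) (fun r hr => y1 r (by omega)) hg
  rw [vmax_ncons (by omega), vmax_ncons (by omega), vmin_ncons (by omega), vmin_ncons (by omega),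
    Nat.succ_eq_add_one,
    pad_first _ _ _ _ _ (fun r => (a2 (Nat.zero_le r)).trans (by omega)),
    pad_first _ _ _ _ _ (fun r => (smax_anti a1 a2 (Nat.zero_le r)).trans
      (max_le (by omega) ((a1 (Nat.zero_le 1)).trans (by omega)))),
    pad_last _ _ _ _ (z1 k le_rfl) (y1 k le_rfl),
    pad_last _ _ _ _ (zs _ _ z1 z2 (fun h => z1 0 (by omega)))
      (zs _ _ y1 y2 (fun h => y1 0 (by omega)))] at h
  rw [mul_comm (skewSchur N k (smin l1 l2) (smin m1 m2)), mul_comm (skewSchur N k l1 m1)]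
  exact h

/-- multiset of the first `k` parts -/
def ms (k : ℕ) (u : ℕ → ℕ) : Multiset ℕ := ∑ r ∈ range k, {u r}
/-- potential of a part sequence placed at `p, p + n, ...` -/
def pot (n k p : ℕ) (u : ℕ → ℕ) : ℕ := ∑ r ∈ range k, (p + r * n) * u r

lemma ms_eq (k : ℕ) (u : ℕ → ℕ) : (range k).val.map u = ms k u := by
  unfold ms
  have := Multiset.map_map (fun x : ℕ => ({x} : Multiset ℕ)) u (range k).val
  rw [Finset.sum]
  exact (Multiset.sum_map_singleton _).symm.trans (congrArg Multiset.sum this)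

lemma single_max_min (x y : ℕ) :
    ({max x y} : Multiset ℕ) + {min x y} = {x} + {y} := by
  rcases le_total x y with h | h
  · rw [max_eq_right h, min_eq_left h, add_comm]
  · rw [max_eq_left h, min_eq_right h]

lemma wt_max_min {e f x y : ℕ} (h : e < f) :
    e * max x y + f * min x y ≤ e * x + f * y ∧
    (x < y → e * max x y + f * min x y < e * x + f * y) := by
  rcases le_or_gt y x with h1 | h1
  · rw [max_eq_left h1, min_eq_right h1]
    exact ⟨le_rfl, fun h2 => by omega⟩
  · rw [max_eq_right h1.le, min_eq_left h1.le]
    have : e * y + f * x < e * x + f * y := by nlinarith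
    exact ⟨this.le, fun _ => this⟩

/-- admissible replacement of a pair of part sequences at positions `p`, `q` -/
structure Repl (n k p q : ℕ) (u v u' v' : ℕ → ℕ) : Prop where
  anti1 : Antitone u'
  anti2 : Antitone v'
  zero1 : ∀ r, k ≤ r → u' r = 0
  zero2 : ∀ r, k ≤ r → v' r = 0
  mset : ms k u' + ms k v' = ms k u + ms k v
  pote : pot n k p u' + pot n k q v' ≤ pot n k p u + pot n k q v

section replace
variable {n k p q : ℕ} {u v : ℕ → ℕ}

lemma repl_v
    (hpq : p < q) (hu : Antitone u) (hv : Antitone v) (zu : ∀ r, k ≤ r → u r = 0) (zv : ∀ r, k ≤ r → v r = 0) : Repl n k p q u v (vmax u v) (vmin u v) where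
  anti1 := vmax_anti hu hv
  anti2 := vmin_anti hu hv
  zero1 r hr := by simp [vmax, zu r hr, zv r hr]
  zero2 r hr := by simp [vmin, zu r hr]
  mset := by
    unfold ms
    rw [← sum_add_distrib, ← sum_add_distrib]
    exact sum_congr rfl fun r _ => single_max_min _ _
  pote := by
    unfold pot
    rw [← sum_add_distrib, ← sum_add_distrib]
    exact sum_le_sum fun r _ => (wt_max_min (by omega)).1

lemma pot_v_lt
    (hpq : p < q) (zv : ∀ r, k ≤ r → v r = 0) {r : ℕ} (hr : u r < v r) :
    pot n k p (vmax u v) + pot n k q (vmin u v) < pot n k p u + pot n k q v := by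
  unfold pot
  rw [← sum_add_distrib, ← sum_add_distrib]
  refine sum_lt_sum (fun r _ => (wt_max_min (by omega)).1) ⟨r, ?_, (wt_max_min (by omega)).2 hr⟩
  rw [mem_range]
  by_contra h
  have := zv r (by omega)
  omega

lemma smin_zero (zu : ∀ r, k ≤ r → u r = 0) (r : ℕ) (hr : k ≤ r) : smin u v r = 0 := by
  cases r with
  | zero => exact zu 0 hr
  | succ r => show min _ _ = 0; rw [zu _ hr]; simp

lemma ms_shift {w : ℕ → ℕ} (zw : w k = 0) : ms k w + {0} = ms k (fun r => w (r + 1)) + {w 0} := by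
  unfold ms
  rw [← sum_range_succ' (fun r => ({w r} : Multiset ℕ)), sum_range_succ, zw]

lemma pot_shift {w : ℕ → ℕ} (zw : w k = 0) :
    pot n k p w = pot n k (p + n) (fun r => w (r + 1)) + p * w 0 := by
  have h1 : pot n k p w = ∑ r ∈ range (k + 1), (p + r * n) * w r := by
    rw [sum_range_succ, zw, mul_zero, add_zero]; rfl
  rw [h1, sum_range_succ', zero_mul, add_zero]
  congr 1
  exact sum_congr rfl fun r _ => by ring

lemma repl_s
    (hpq : p < q) (hqn : q < n) (hu : Antitone u) (hv : Antitone v) (zu : ∀ r, k ≤ r → u r = 0) (zv : ∀ r, k ≤ r → v r = 0) : Repl n k p q u v (smin u v) (smax u v) where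
  anti1 := smin_anti hu hv
  anti2 := smax_anti hu hv
  zero1 := smin_zero zu
  zero2 r hr := by simp [smax, zv r hr, zu (r + 1) (by omega)]
  mset := by
    have h1 := ms_shift (zu k le_rfl)
    have h2 := ms_shift (smin_zero (v := v) zu k le_rfl)
    have h3 : ms k (fun r => smin u v (r + 1)) + ms k (smax u v)
        = ms k (fun r => u (r + 1)) + ms k v := by
      unfold ms
      rw [← sum_add_distrib, ← sum_add_distrib]
      refine sum_congr rfl fun r _ => ?_
      rw [add_comm, add_comm {u (r + 1)}]
      exact single_max_min _ _
    apply add_right_cancel (b := ({0} : Multiset ℕ))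
    rw [add_right_comm, h2, add_right_comm, h3, add_right_comm (ms k u), h1]
    rw [add_right_comm]; rfl
  pote := by
    rw [pot_shift (zu k le_rfl), pot_shift (smin_zero (v := v) zu k le_rfl)]
    have h3 : pot n k q (smax u v) + pot n k (p + n) (fun r => smin u v (r + 1))
        ≤ pot n k q v + pot n k (p + n) (fun r => u (r + 1)) := by
      unfold pot
      rw [← sum_add_distrib, ← sum_add_distrib]
      exact sum_le_sum fun r _ => (wt_max_min (by omega)).1
    have : smin u v 0 = u 0 := rfl
    rw [this]; omega

lemma pot_s_lt
    (hqn : q < n) (zu : ∀ r, k ≤ r → u r = 0) {r : ℕ} (hr : v r < u (r + 1)) :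
    pot n k p (smin u v) + pot n k q (smax u v) < pot n k p u + pot n k q v := by
  rw [pot_shift (zu k le_rfl), pot_shift (smin_zero (v := v) zu k le_rfl)]
  have h3 : pot n k q (smax u v) + pot n k (p + n) (fun r => smin u v (r + 1))
      < pot n k q v + pot n k (p + n) (fun r => u (r + 1)) := by
    unfold pot
    rw [← sum_add_distrib, ← sum_add_distrib]
    refine sum_lt_sum (fun r _ => (wt_max_min (by omega)).1) ⟨r, ?_, (wt_max_min (by omega)).2 hr⟩
    rw [mem_range]
    by_contra h
    have := zu (r + 1) (by omega)
    omega
  have : smin u v 0 = u 0 := rfl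
  rw [this]; omega
end replace

def upd {n : ℕ} (l : Fin n → ℕ → ℕ) (p q : Fin n) (u v : ℕ → ℕ) : Fin n → ℕ → ℕ :=
  fun i => if i = p then u else if i = q then v else l i

lemma sum_two {n : ℕ} {A : Type*} [AddCommMonoid A] {p q : Fin n} (hpq : p ≠ q) (f : Fin n → A) :
    ∑ i, f i = f p + f q + ∑ i ∈ (univ.erase p).erase q, f i := by
  rw [← add_sum_erase univ f (mem_univ p),
    ← add_sum_erase (univ.erase p) f (mem_erase.mpr ⟨hpq.symm, mem_univ q⟩), add_assoc]

lemma prod_two {n : ℕ} {A : Type*} [CommMonoid A] {p q : Fin n} (hpq : p ≠ q) (f : Fin n → A) :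
    ∏ i, f i = f p * f q * ∏ i ∈ (univ.erase p).erase q, f i := by
  rw [← mul_prod_erase univ f (mem_univ p),
    ← mul_prod_erase (univ.erase p) f (mem_erase.mpr ⟨hpq.symm, mem_univ q⟩), mul_assoc]

lemma upd_p {n : ℕ} (l : Fin n → ℕ → ℕ) (p q : Fin n) (u v : ℕ → ℕ) : upd l p q u v p = u := by
  simp [upd]
lemma upd_q {n : ℕ} (l : Fin n → ℕ → ℕ) {p q : Fin n} (h : p ≠ q) (u v : ℕ → ℕ) :
    upd l p q u v q = v := by
  simp [upd, h.symm]
lemma upd_o {n : ℕ} (l : Fin n → ℕ → ℕ) {p q : Fin n} (u v : ℕ → ℕ) {i : Fin n}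
    (hi : i ∈ (univ.erase p).erase q) : upd l p q u v i = l i := by
  rw [mem_erase, mem_erase] at hi
  simp [upd, hi.1, hi.2.1]

/-- total potential -/
def tpot (n k : ℕ) (l : Fin n → ℕ → ℕ) : ℕ := ∑ i : Fin n, pot n k i (l i)
def tms (n k : ℕ) (l : Fin n → ℕ → ℕ) : Multiset ℕ := ∑ i : Fin n, ms k (l i)

section fam
variable {n k : ℕ} {l : Fin n → ℕ → ℕ} {p q : Fin n} {u v : ℕ → ℕ}

lemma upd_tms
    (hpq : p ≠ q) (h : Repl n k p q (l p) (l q) u v) : tms n k (upd l p q u v) = tms n k l := by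
  unfold tms
  rw [sum_two hpq, sum_two hpq (fun i => ms k (l i)), upd_p, upd_q _ hpq, h.mset,
    sum_congr rfl (fun i hi => by rw [upd_o _ _ _ hi])]

lemma upd_tpot
    (hpq : p ≠ q) (u v : ℕ → ℕ) : tpot n k (upd l p q u v) + (pot n k p (l p) + pot n k q (l q))
    = tpot n k l + (pot n k p u + pot n k q v) := by
  unfold tpot
  rw [sum_two hpq, sum_two hpq (fun i => pot n k i (l i)), upd_p, upd_q _ hpq,
    sum_congr rfl (fun i hi => by rw [upd_o _ _ _ hi])]
  omega

lemma upd_anti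
    (h : Repl n k p q (l p) (l q) u v) (hl : ∀ i, Antitone (l i)) (i : Fin n) : Antitone (upd l p q u v i) := by
  unfold upd
  split_ifs
  · exact h.anti1
  · exact h.anti2
  · exact hl i

lemma upd_zero
    (h : Repl n k p q (l p) (l q) u v) (hl : ∀ i r, k ≤ r → l i r = 0) (i : Fin n) (r : ℕ) (hr : k ≤ r) :
    upd l p q u v i r = 0 := by
  unfold upd
  split_ifs
  · exact h.zero1 r hr
  · exact h.zero2 r hr
  · exact hl i r hr
end fam

lemma SN_prod {n k N : ℕ} (hk : 0 < k) {l m : Fin n → ℕ → ℕ}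
    (hl : ∀ i, Antitone (l i)) (hm : ∀ i, Antitone (m i))
    (zl : ∀ i r, k ≤ r → l i r = 0) (zm : ∀ i r, k ≤ r → m i r = 0) (s : Finset (Fin n)) :
    ∏ i ∈ s, skewSchur N k (l i) (m i) ∈ SN N := by
  classical
  induction s using Finset.induction_on with
  | empty => rw [prod_empty]; exact SN_one N
  | insert a s ha ih =>
    rw [prod_insert ha, mul_comm]
    exact SN_mul_skew hk (hl a) (hm a) (zl a) (zm a) ih

lemma SN_step {n k N : ℕ} (hk : 0 < k) {l m : Fin n → ℕ → ℕ}
    (hl : ∀ i, Antitone (l i)) (hm : ∀ i, Antitone (m i))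
    (zl : ∀ i r, k ≤ r → l i r = 0) (zm : ∀ i r, k ≤ r → m i r = 0) {p q : Fin n} (hpq : p ≠ q)
    {u v u' v' : ℕ → ℕ}
    (h : ∀ g ∈ SN N, g * (skewSchur N k u u' * skewSchur N k v v'
      - skewSchur N k (l p) (m p) * skewSchur N k (l q) (m q)) ∈ SN N) :
    ∏ i, skewSchur N k (upd l p q u v i) (upd m p q u' v' i)
      - ∏ i, skewSchur N k (l i) (m i) ∈ SN N := by
  have := h _ (SN_prod hk hl hm zl zm ((univ.erase p).erase q))
  rw [prod_two hpq, prod_two hpq (fun i => skewSchur N k (l i) (m i)), upd_p, upd_p, upd_q _ hpq,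
    upd_q _ hpq, prod_congr rfl (fun i hi => by rw [upd_o _ _ _ hi, upd_o _ _ _ hi]), ← sub_mul,
    mul_comm]
  exact this

/-- two antitone sequences with the same multiset of first parts -/
lemma anti_unique {K : ℕ} {a b : ℕ → ℕ} (ha : Antitone a) (hb : Antitone b)
    (h : ms K a = ms K b) : ∀ e < K, a e = b e := by
  rw [← ms_eq, ← ms_eq] at h
  have hs : ∀ c : ℕ → ℕ, Antitone c → ((List.range K).map c).Pairwise (· ≥ ·) := by
    intro c hc
    rw [List.pairwise_map]
    exact List.pairwise_lt_range.imp fun h => hc h.le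
  have hp : ((List.range K).map a).Perm ((List.range K).map b) := by
    rw [← Multiset.coe_eq_coe]; exact h
  have := hp.eq_of_pairwise (fun x y _ _ h1 h2 => le_antisymm h2 h1) (hs a ha) (hs b hb)
  intro e he
  exact List.map_inj_left.mp this e (List.mem_range.mpr he)

lemma ms_total (n : ℕ) (a : ℕ → ℕ) (k : ℕ) :
    ms (n * k) a = tms n k (fun i r => a (i + r * n)) := by
  unfold tms ms
  rw [sum_comm]
  induction k with
  | zero => simp
  | succ k ih =>
    rw [Nat.mul_succ, sum_range_add, ih, sum_range_succ]
    congr 1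
    rw [sum_range]
    refine sum_congr rfl fun x _ => ?_
    rw [add_comm, mul_comm n k]

/-- stable families are obtained from a single antitone sequence -/
lemma stable_eq {n k : ℕ} {l : Fin n → ℕ → ℕ} (hl : ∀ i, Antitone (l i))
    (zl : ∀ i r, k ≤ r → l i r = 0) (h1 : ∀ p q : Fin n, p < q → ∀ r, l q r ≤ l p r)
    (h2 : ∀ p q : Fin n, p < q → ∀ r, l p (r + 1) ≤ l q r)
    {Lam : ℕ → ℕ} (hL : Antitone Lam) (zL : ∀ j, n * k ≤ j → Lam j = 0)
    (hms : ms (n * k) Lam = tms n k l) (i : Fin n) : l i = fun j => Lam (i + j * n) := by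
  have hn : 0 < n := i.pos
  let a : ℕ → ℕ := fun e => l ⟨e % n, Nat.mod_lt e hn⟩ (e / n)
  have hal : ∀ (i : Fin n) r, a (i + r * n) = l i r := by
    intro i r
    show l _ _ = _
    congr 1
    · congr 1
      show (i + r * n) % n = i
      rw [Nat.add_mul_mod_self_right, Nat.mod_eq_of_lt i.2]
    · rw [Nat.add_mul_div_right _ _ hn, Nat.div_eq_of_lt i.2, zero_add]
  have ha : Antitone a := by
    apply antitone_nat_of_succ_le
    intro e
    obtain ⟨i, r, rfl⟩ : ∃ (i : Fin n) (r : ℕ), e = i + r * n :=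
      ⟨⟨e % n, Nat.mod_lt e hn⟩, e / n, by
        show e = e % n + e / n * n
        rw [mul_comm]; exact (Nat.mod_add_div e n).symm⟩
    rw [hal]
    by_cases hi : (i : ℕ) + 1 < n
    · have := hal ⟨i + 1, hi⟩ r
      rw [show (i : ℕ) + r * n + 1 = ((⟨i + 1, hi⟩ : Fin n) : ℕ) + r * n by simp; ring, this]
      exact h1 _ _ (by rw [Fin.lt_def]; simp) r
    · have hi' : (i : ℕ) + 1 = n := by have := i.2; omega
      rw [show (i : ℕ) + r * n + 1 = ((⟨0, hn⟩ : Fin n) : ℕ) + (r + 1) * n by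
        rw [add_mul, one_mul]; show _ = 0 + _; omega, hal]
      by_cases h0 : (i : ℕ) = 0
      · rw [show i = ⟨0, hn⟩ from Fin.ext h0]
        exact hl _ (Nat.le_succ r)
      · exact h2 _ _ (by rw [Fin.lt_def]; show 0 < _; omega) r
  have hu := anti_unique (K := n * k) ha hL (by
    rw [ms_total, hms]
    congr 1
    funext i r
    exact hal i r)
  funext j
  by_cases hj : j < k
  · rw [← hal i j]
    apply hu
    have := i.2
    have : (j + 1) * n ≤ k * n := Nat.mul_le_mul_right n hj
    rw [mul_comm n k]
    rw [add_mul] at this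
    omega
  · rw [zl i j (by omega), zL]
    have : k * n ≤ j * n := Nat.mul_le_mul_right n (by omega)
    rw [mul_comm n k]; omega

lemma reduce {n k N : ℕ} (hk : 0 < k) {Lam M : ℕ → ℕ} (hL : Antitone Lam) (hM : Antitone M)
    (zL : ∀ j, n * k ≤ j → Lam j = 0) (zM : ∀ j, n * k ≤ j → M j = 0) (P : ℕ) :
    ∀ l m : Fin n → ℕ → ℕ, (∀ i, Antitone (l i)) → (∀ i, Antitone (m i)) →
    (∀ i r, k ≤ r → l i r = 0) → (∀ i r, k ≤ r → m i r = 0) →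
    ms (n * k) Lam = tms n k l → ms (n * k) M = tms n k m → tpot n k l + tpot n k m = P →
    ∏ i : Fin n, skewSchur N k (fun j => Lam (i + j * n)) (fun j => M (i + j * n))
        - ∏ i : Fin n, skewSchur N k (l i) (m i) ∈ SN N := by
  induction P using Nat.strong_induction_on with
  | _ P ih =>
  intro l m hl hm zl zm el em hP
  have key : ∀ p q : Fin n, p < q → ∀ u v u' v' : ℕ → ℕ, Repl n k p q (l p) (l q) u v →
      Repl n k p q (m p) (m q) u' v' →
      (pot n k p u + pot n k q v < pot n k p (l p) + pot n k q (l q) ∨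
       pot n k p u' + pot n k q v' < pot n k p (m p) + pot n k q (m q)) →
      (∀ g ∈ SN N, g * (skewSchur N k u u' * skewSchur N k v v'
        - skewSchur N k (l p) (m p) * skewSchur N k (l q) (m q)) ∈ SN N) →
      ∏ i : Fin n, skewSchur N k (fun j => Lam (i + j * n)) (fun j => M (i + j * n))
        - ∏ i : Fin n, skewSchur N k (l i) (m i) ∈ SN N := by
    intro p q hpq u v u' v' R1 R2 hlt hg
    have hne := hpq.ne
    have s1 := SN_step hk hl hm zl zm hne hg
    have t1 := upd_tpot (k := k) (l := l) hne u v
    have t2 := upd_tpot (k := k) (l := m) hne u' v'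
    have q1 := R1.pote
    have q2 := R2.pote
    have s2 := ih _ (by omega) (upd l p q u v) (upd m p q u' v') (upd_anti R1 hl) (upd_anti R2 hm)
      (upd_zero R1 zl) (upd_zero R2 zm) (by rw [upd_tms hne R1, el]) (by rw [upd_tms hne R2, em]) rfl
    have := AddSubmonoid.add_mem _ s2 s1
    rwa [sub_add_sub_cancel] at this
  by_cases hA : ∃ p q : Fin n, p < q ∧ ∃ r, l p r < l q r ∨ m p r < m q r
  · obtain ⟨p, q, hpq, r, hr⟩ := hA
    refine key p q hpq _ _ _ _ (repl_v hpq (hl p) (hl q) (zl p) (zl q))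
      (repl_v hpq (hm p) (hm q) (zm p) (zm q)) ?_ ?_
    · exact hr.imp (fun h => pot_v_lt hpq (zl q) h) (fun h => pot_v_lt hpq (zm q) h)
    · intro g hg
      exact SN_mul_diff hk (hl p) (hm p) (zl p) (zm p) (hl q) (hm q) (zl q) (zm q) hg
  by_cases hB : ∃ p q : Fin n, p < q ∧ ∃ r, l q r < l p (r + 1) ∨ m q r < m p (r + 1)
  · obtain ⟨p, q, hpq, r, hr⟩ := hB
    refine key p q hpq _ _ _ _ (repl_s hpq q.2 (hl p) (hl q) (zl p) (zl q))
      (repl_s hpq q.2 (hm p) (hm q) (zm p) (zm q)) ?_ ?_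
    · exact hr.imp (fun h => pot_s_lt q.2 (zl p) h) (fun h => pot_s_lt q.2 (zm p) h)
    · intro g hg
      exact SN_mul_shift (hl p) (hl q) (hm p) (hm q) (zl p) (zl q) (zm p) (zm q) hg
  push Not at hA hB
  have e1 := stable_eq hl zl (fun p q h r => (hA p q h r).1) (fun p q h r => (hB p q h r).1) hL zL el
  have e2 := stable_eq hm zm (fun p q h r => (hA p q h r).2) (fun p q h r => (hB p q h r).2) hM zM em
  have : ∏ i : Fin n, skewSchur N k (l i) (m i)
      = ∏ i : Fin n, skewSchur N k (fun j => Lam (i + j * n)) (fun j => M (i + j * n)) :=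
    prod_congr rfl fun i _ => by rw [← e1 i, ← e2 i]
  rw [this, sub_self]
  exact AddSubmonoid.zero_mem _


end proofdev

/-- Let `λ⁽¹⁾/μ⁽¹⁾, …, λ⁽ⁿ⁾/μ⁽ⁿ⁾` be `n` skew shapes (each with at most `k`
parts), let `Λ = ⋃ᵢ λ⁽ⁱ⁾` be the weakly decreasing rearrangement of all parts
of all the `λ⁽ⁱ⁾`, and `M = ⋃ᵢ μ⁽ⁱ⁾`. Then
`∏_{i=1}^n s_{Λ^{[i,n]}/M^{[i,n]}} ≥_s ∏_{i=1}^n s_{λ⁽ⁱ⁾/μ⁽ⁱ⁾}`, where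
`λ^{[i,n]} = (λ_i, λ_{i+n}, λ_{i+2n}, …)` (0-indexed: `j ↦ λ (i + j n)` for
`i : Fin n`). -/
theorem schur_nonneg_union_quotients (n k : ℕ) (lam mu : Fin n → ℕ → ℕ)
    (hlam : ∀ i, Antitone (lam i)) (hmu : ∀ i, Antitone (mu i))
    (hlamk : ∀ i, ∀ j, k ≤ j → lam i j = 0) (hmuk : ∀ i, ∀ j, k ≤ j → mu i j = 0)
    (hml : ∀ i, ∀ j, mu i j ≤ lam i j)
    (Lam M : ℕ → ℕ) (hLam : Antitone Lam) (hM : Antitone M)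
    (hLamk : ∀ j, n * k ≤ j → Lam j = 0) (hMk : ∀ j, n * k ≤ j → M j = 0)
    (hLamUnion : (Finset.range (n * k)).val.map Lam
      = ∑ i : Fin n, (Finset.range k).val.map (lam i))
    (hMUnion : (Finset.range (n * k)).val.map M
      = ∑ i : Fin n, (Finset.range k).val.map (mu i))
    (N : ℕ) :
    IsSchurNonneg N
      (∏ i : Fin n, skewSchur N k (fun j => Lam (i + j * n)) (fun j => M (i + j * n))
        - ∏ i : Fin n, skewSchur N k (lam i) (mu i)) := by
  apply SN_nonneg
  rcases Nat.eq_zero_or_pos k with hk | hk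
  · subst hk
    simp only [skewSchur, Matrix.det_fin_zero, sub_self]
    exact AddSubmonoid.zero_mem _
  · simp only [ms_eq] at hLamUnion hMUnion
    exact reduce hk hLam hM hLamk hMk _ lam mu hlam hmu hlamk hmuk hLamUnion hMUnion rfl
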